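/- arXiv:1407.7437 — 12 statements merged into one kernel-verified Lean document; each statement's English description precedes it below -/
import Mathlib

section
/- (Milliken–Taylor Theorem for Fin) For each finite coloring of the set [Fin]² of 2-element subsets of Fin, there are nonempty finite sets F₁ < F₂ < ⋯ of natural numbers such that the sum graph of the sequence (Fₙ) (a proper sequence in the semigroup Fin) is monochromatic; that is, all pairs {F_G, F_H} = {⋃_{n∈G}Fₙ, ⋃_{n∈H}Fₙ}, for nonempty finite sets G < H of indices, have the same color. -/
/-- The sum `a_F = a_{i₁} + ⋯ + a_{i_k}` for `F = {i₁ < ⋯ < i_k}`,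
summed in increasing order of indices (junk value `a 0` if `F = ∅`). -/
def fsum {S : Type*} [AddSemigroup S] (a : ℕ → S) (F : Finset ℕ) : S :=
  match (F.sort (· ≤ ·)).map a with
  | [] => a 0
  | x :: xs => xs.foldl (· + ·) x

/-- `F < H` for finite sets of naturals: every element of `F` is below every element of `H`. -/
def FinsetLT (F H : Finset ℕ) : Prop := ∀ i ∈ F, ∀ j ∈ H, i < j

/-- A sequence is proper if `b_F ≠ b_H` for all nonempty finite `F < H`. -/
def IsProper {S : Type*} [AddSemigroup S] (b : ℕ → S) : Prop :=
  ∀ F H : Finset ℕ, F.Nonempty → H.Nonempty → FinsetLT F H → fsum b F ≠ fsum b H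

/-- `b` is a sumsequence of `a`: `b n = a_{Fₙ}` for nonempty finite sets `F₀ < F₁ < ⋯`. -/
def IsSumSeq {S : Type*} [AddSemigroup S] (a b : ℕ → S) : Prop :=
  ∃ F : ℕ → Finset ℕ, (∀ n, (F n).Nonempty) ∧ (∀ n, FinsetLT (F n) (F (n + 1))) ∧
    ∀ n, b n = fsum a (F n)

/-- The set of finite sums of the sequence `a`. -/
def FSset {S : Type*} [AddSemigroup S] (a : ℕ → S) : Set S :=
  {s | ∃ F : Finset ℕ, F.Nonempty ∧ fsum a F = s}

/-- The set of finite sums of the tail `aₙ, aₙ₊₁, …`. -/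
def FStail {S : Type*} [AddSemigroup S] (a : ℕ → S) (n : ℕ) : Set S :=
  {s | ∃ F : Finset ℕ, F.Nonempty ∧ (∀ i ∈ F, n ≤ i) ∧ fsum a F = s}

/-- Union semigroup on finite sets (type synonym). -/
def UFin := Finset ℕ

instance UFin.instSemigroup : Semigroup UFin where
  mul A B := ((A : Finset ℕ) ∪ (B : Finset ℕ) : Finset ℕ)
  mul_assoc A B C := Finset.union_assoc (α := ℕ) A B C

open Filter in
theorem exists_good_ultrafilter : ∃ U : Ultrafilter (Finset ℕ),
    (∀ p : Finset ℕ → Prop, (∀ᶠ A in (U : Filter (Finset ℕ)), p A) → ∀ᶠ A in (U : Filter (Finset ℕ)), ∀ᶠ B in (U : Filter (Finset ℕ)), p (A ∪ B)) ∧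
    ∀ n : ℕ, ∀ᶠ A in (U : Filter (Finset ℕ)), A.Nonempty ∧ ∀ i ∈ A, n ≤ i := by
  let _ : Semigroup (Ultrafilter UFin) := Ultrafilter.semigroup
  let S : Set (Ultrafilter UFin) :=
    ⋂ n : ℕ, { U | ∀ᶠ A in (U : Filter UFin), Finset.Nonempty (α := ℕ) A ∧ ∀ i ∈ (show Finset ℕ from A), n ≤ i }
  have h := exists_idempotent_in_compact_subsemigroup (M := Ultrafilter UFin) ?_ S ?_ ?_ ?_
  · rcases h with ⟨U, hU, U_idem⟩
    refine ⟨U, fun p hp => ?_, fun n => Set.mem_iInter.mp hU n⟩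
    have hp' : ∀ᶠ A in ((U * U : Ultrafilter UFin) : Filter UFin), p A := by
      rw [U_idem]; exact hp
    exact hp'
  · exact Ultrafilter.continuous_mul_left
  · apply IsCompact.nonempty_iInter_of_sequence_nonempty_isCompact_isClosed
    · intro n U hU
      refine Filter.Eventually.mono hU ?_
      rintro A ⟨h1, h2⟩
      exact ⟨h1, fun i hi => (Nat.le_succ n).trans (h2 i hi)⟩
    · intro n
      refine ⟨(pure ({n} : Finset ℕ) : Ultrafilter (Finset ℕ)), ?_⟩
      refine mem_pure.mpr ?_
      exact ⟨Finset.singleton_nonempty n, fun i hi => (Finset.mem_singleton.mp hi).ge⟩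
    · exact (ultrafilter_isClosed_basic _).isCompact
    · intro n
      apply ultrafilter_isClosed_basic
  · exact IsClosed.isCompact (isClosed_iInter fun i => ultrafilter_isClosed_basic _)
  · intro U hU V hV
    rw [Set.mem_iInter] at *
    intro n
    refine (Ultrafilter.eventually_mul U V _).2 ?_
    refine Filter.Eventually.mono (hU n) ?_
    rintro A ⟨h1, h2⟩
    refine Filter.Eventually.mono (hV n) ?_
    rintro B ⟨h3, h4⟩
    refine ⟨Finset.Nonempty.mono Finset.subset_union_left h1, fun i hi => ?_⟩
    rcases Finset.mem_union.mp hi with hi | hi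
    · exact h2 i hi
    · exact h4 i hi

open Filter in
/-- Star of a predicate. -/
def mtStar (U : Ultrafilter (Finset ℕ)) (p : Finset ℕ → Prop) (A : Finset ℕ) : Prop :=
  p A ∧ ∀ᶠ B in (U : Filter (Finset ℕ)), p (A ∪ B)

open Filter in
theorem mtStar_ev (U : Ultrafilter (Finset ℕ))
    (hU : ∀ p : Finset ℕ → Prop, (∀ᶠ A in (U : Filter (Finset ℕ)), p A) → ∀ᶠ A in (U : Filter (Finset ℕ)), ∀ᶠ B in (U : Filter (Finset ℕ)), p (A ∪ B))
    (p : Finset ℕ → Prop) (hp : ∀ᶠ A in (U : Filter (Finset ℕ)), p A) : ∀ᶠ A in (U : Filter (Finset ℕ)), mtStar U p A :=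
  hp.and (hU p hp)

open Filter in
theorem mtStar_union (U : Ultrafilter (Finset ℕ))
    (hU : ∀ p : Finset ℕ → Prop, (∀ᶠ A in (U : Filter (Finset ℕ)), p A) → ∀ᶠ A in (U : Filter (Finset ℕ)), ∀ᶠ B in (U : Filter (Finset ℕ)), p (A ∪ B))
    (p : Finset ℕ → Prop) (A : Finset ℕ) (hp : mtStar U p A) :
    ∀ᶠ B in (U : Filter (Finset ℕ)), mtStar U p (A ∪ B) := by
  have := hU _ hp.2
  filter_upwards [hp.2, this] with B h1 h2
  refine ⟨h1, ?_⟩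
  filter_upwards [h2] with C h3
  rwa [Finset.union_assoc]

/-- The next stage. -/
def mtNext (T : Finset (Finset ℕ × Finset ℕ)) (A : Finset ℕ) : Finset (Finset ℕ × Finset ℕ) :=
  T ∪ T.image (fun P => (P.1, P.2 ∪ A)) ∪ T.image (fun P => (P.1 ∪ A, ∅))

/-- **Milliken–Taylor Theorem for `Fin`**, the semigroup of nonempty finite subsets of `ℕ`
under union. For each finite coloring of the 2-element subsets of `Fin`, there are nonempty
finite sets `F₀ < F₁ < ⋯` forming a proper sequence whose sum graph is monochromatic:
all pairs `{⋃_{n∈G} Fₙ, ⋃_{n∈H} Fₙ}` for nonempty finite `G < H` get the same color. -/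
theorem milliken_taylor_fin (r : ℕ) (χ : Sym2 (Finset ℕ) → Fin r) :
    ∃ F : ℕ → Finset ℕ, (∀ n, (F n).Nonempty) ∧ (∀ n, FinsetLT (F n) (F (n + 1))) ∧
      (∀ G H : Finset ℕ, G.Nonempty → H.Nonempty → FinsetLT G H →
        G.biUnion F ≠ H.biUnion F) ∧
      ∃ c : Fin r, ∀ G H : Finset ℕ, G.Nonempty → H.Nonempty → FinsetLT G H →
        χ s(G.biUnion F, H.biUnion F) = c := by
  obtain ⟨U, hU, hlarge⟩ := exists_good_ultrafilter
  have hc1 : ∀ A, ∃ c : Fin r, ∀ᶠ B in (U : Filter (Finset ℕ)), χ s(A, B) = c := by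
    intro A
    exact (Ultrafilter.eventually_exists_iff).1 (Filter.Eventually.of_forall fun B => ⟨_, rfl⟩)
  choose cA hcA using hc1
  obtain ⟨c, hc⟩ : ∃ c : Fin r, ∀ᶠ A in (U : Filter (Finset ℕ)), cA A = c :=
    (Ultrafilter.eventually_exists_iff).1 (Filter.Eventually.of_forall fun B => ⟨_, rfl⟩)
  let D : Finset ℕ → Prop := fun A => ∀ᶠ B in (U : Filter (Finset ℕ)), χ s(A, B) = c
  have hD : ∀ᶠ A in (U : Filter (Finset ℕ)), D A := by
    filter_upwards [hc] with A hA
    have := hcA A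
    rwa [hA] at this
  let Q : Finset ℕ × Finset ℕ → Prop := fun P =>
    (P.1.Nonempty → mtStar U D P.1) ∧
    (P.1.Nonempty → P.2.Nonempty → mtStar U (fun B => χ s(P.1, B) = c) P.2)
  have hQ1 : ∀ P, Q P → ∀ᶠ A in (U : Filter (Finset ℕ)), Q (P.1, P.2 ∪ A) := by
    rintro ⟨X, Y⟩ ⟨h1, h2⟩
    by_cases hX : X.Nonempty
    · have : ∀ᶠ A in (U : Filter (Finset ℕ)), mtStar U (fun B => χ s(X, B) = c) (Y ∪ A) := by
        rcases Y.eq_empty_or_nonempty with rfl | hY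
        · simpa using mtStar_ev U hU _ (h1 hX).1
        · exact mtStar_union U hU _ _ (h2 hX hY)
      filter_upwards [this] with A hA
      exact ⟨h1, fun _ _ => hA⟩
    · exact Filter.Eventually.of_forall fun A => ⟨h1, fun h => absurd h hX⟩
  have hQ2 : ∀ P, Q P → ∀ᶠ A in (U : Filter (Finset ℕ)), Q (P.1 ∪ A, ∅) := by
    rintro ⟨X, Y⟩ ⟨h1, h2⟩
    have : ∀ᶠ A in (U : Filter (Finset ℕ)), mtStar U D (X ∪ A) := by
      rcases X.eq_empty_or_nonempty with rfl | hX
      · simpa using mtStar_ev U hU _ hD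
      · exact mtStar_union U hU _ _ (h1 hX)
    filter_upwards [this] with A hA
    exact ⟨fun _ => hA, fun _ h => absurd h (by simp)⟩
  have step : ∀ T : {T : Finset (Finset ℕ × Finset ℕ) // ∀ P ∈ T, Q P}, ∃ A : Finset ℕ,
      A.Nonempty ∧ (∀ P ∈ T.1, FinsetLT P.1 A) ∧ ∀ P ∈ mtNext T.1 A, Q P := by
    rintro ⟨T, hT⟩
    have e1 : ∀ᶠ A in (U : Filter (Finset ℕ)), ∀ P ∈ T, Q (P.1, P.2 ∪ A) :=
      (Finset.eventually_all T).2 fun P hP => hQ1 P (hT P hP)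
    have e2 : ∀ᶠ A in (U : Filter (Finset ℕ)), ∀ P ∈ T, Q (P.1 ∪ A, ∅) :=
      (Finset.eventually_all T).2 fun P hP => hQ2 P (hT P hP)
    have e3 : ∀ᶠ A in (U : Filter (Finset ℕ)), ∀ P ∈ T, FinsetLT P.1 A := by
      refine (Finset.eventually_all T).2 fun P hP => ?_
      filter_upwards [hlarge (P.1.sup id + 1)] with A hA i hi j hj
      have h1 := hA.2 j hj
      have h2 : i ≤ P.1.sup id := Finset.le_sup (f := id) hi
      omega
    obtain ⟨A, h1, h2, h3, h4⟩ := (e1.and (e2.and (e3.and (hlarge 0)))).exists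
    refine ⟨A, h4.1, h3, fun P hP => ?_⟩
    simp only [mtNext, Finset.mem_union, Finset.mem_image] at hP
    rcases hP with (hP | ⟨R, hR, rfl⟩) | ⟨R, hR, rfl⟩
    · exact hT P hP
    · exact h1 R hR
    · exact h2 R hR
  choose nxt hn1 hn2 hn3 using step
  let T : ℕ → {T : Finset (Finset ℕ × Finset ℕ) // ∀ P ∈ T, Q P} := fun n =>
    Nat.rec ⟨{(∅, ∅)}, by
      intro P hP
      rw [Finset.mem_singleton] at hP
      subst hP
      exact ⟨fun h => absurd h (by simp), fun h => absurd h (by simp)⟩⟩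
      (fun _ S => ⟨mtNext S.1 (nxt S), hn3 S⟩) n
  let F : ℕ → Finset ℕ := fun n => nxt (T n)
  have hT0 : (T 0).1 = {(∅, ∅)} := rfl
  have hTs : ∀ n, (T (n+1)).1 = mtNext (T n).1 (F n) := fun n => rfl
  have key : ∀ n, ∀ G H : Finset ℕ, (∀ i ∈ G, i < n) → (∀ i ∈ H, i < n) → FinsetLT G H →
      (G.biUnion F, H.biUnion F) ∈ (T n).1 := by
    intro n
    induction n with
    | zero =>
      intro G H hG hH _
      have h1 : G = ∅ := Finset.eq_empty_of_forall_notMem fun i hi => by simpa using hG i hi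
      have h2 : H = ∅ := Finset.eq_empty_of_forall_notMem fun i hi => by simpa using hH i hi
      subst h1 h2
      simp [hT0]
    | succ n ih =>
      intro G H hG hH hGH
      rw [hTs]
      simp only [mtNext, Finset.mem_union, Finset.mem_image]
      have er : ∀ K : Finset ℕ, n ∈ K → K.biUnion F = (K.erase n).biUnion F ∪ F n := by
        intro K hK
        conv_lhs => rw [← Finset.insert_erase hK]
        rw [Finset.biUnion_insert, Finset.union_comm]
      have lt : ∀ K : Finset ℕ, (∀ i ∈ K, i < n + 1) → ∀ i ∈ K.erase n, i < n := by
        intro K hK i hi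
        have := hK i (Finset.mem_of_mem_erase hi)
        have := Finset.ne_of_mem_erase hi
        omega
      by_cases hnH : n ∈ H
      · left; right
        refine ⟨(G.biUnion F, (H.erase n).biUnion F), ih G _ (fun i hi => hGH i hi n hnH)
          (lt H hH) (fun i hi j hj => hGH i hi j (Finset.mem_of_mem_erase hj)), ?_⟩
        rw [er H hnH]
      · have hH' : ∀ i ∈ H, i < n := by
          have := lt H hH
          rwa [Finset.erase_eq_of_notMem hnH] at this
        by_cases hnG : n ∈ G
        · right
          have h2 : H = ∅ := Finset.eq_empty_of_forall_notMem fun i hi => by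
            have := hH' i hi
            have := hGH n hnG i hi
            omega
          subst h2
          refine ⟨((G.erase n).biUnion F, (∅ : Finset ℕ).biUnion F), ih _ ∅ (lt G hG)
            (by simp) (fun i hi j hj => by simp at hj), ?_⟩
          rw [er G hnG]; simp
        · left; left
          refine ih G H ?_ hH' hGH
          have := lt G hG
          rwa [Finset.erase_eq_of_notMem hnG] at this
  have hlt : ∀ i n, i < n → FinsetLT (F i) (F n) := by
    intro i n hin
    have := key n {i} ∅ (by simpa using hin) (by simp) (fun a _ b hb => by simp at hb)
    simpa using hn2 (T n) _ this
  have hne : ∀ G : Finset ℕ, G.Nonempty → (G.biUnion F).Nonempty := by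
    rintro G ⟨i, hi⟩
    obtain ⟨x, hx⟩ := hn1 (T i)
    exact ⟨x, Finset.mem_biUnion.2 ⟨i, hi, hx⟩⟩
  refine ⟨F, fun n => hn1 _, fun n => hlt n _ (Nat.lt_succ_self n), ?_, c, ?_⟩
  · intro G H hG hH hGH heq
    obtain ⟨x, hx⟩ := hne G hG
    have hx' := hx
    rw [heq] at hx'
    obtain ⟨i, hi, hxi⟩ := Finset.mem_biUnion.1 hx
    obtain ⟨j, hj, hxj⟩ := Finset.mem_biUnion.1 hx'
    exact lt_irrefl x (hlt i j (hGH i hi j hj) x hxi x hxj)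
  · intro G H hG hH hGH
    have hb : ∀ i ∈ G ∪ H, i < (G ∪ H).sup id + 1 := fun i hi =>
      Nat.lt_succ_of_le (Finset.le_sup (f := id) hi)
    have hm := key ((G ∪ H).sup id + 1) G H (fun i hi => hb i (Finset.mem_union_left _ hi))
      (fun i hi => hb i (Finset.mem_union_right _ hi)) hGH
    have hq := ((T ((G ∪ H).sup id + 1)).2 (G.biUnion F, H.biUnion F) hm).2
    exact (hq (hne G hG) (hne H hH)).1
end

section
/- (Milliken–Taylor Theorem in arbitrary semigroups) Let S be a semigroup and a₁,a₂,… a sequence in S. If the sequence (aₙ) has a proper sumsequence, then for each finite coloring of the set [S]² of 2-element subsets of S, there is a proper sumsequence of (aₙ) whose sum graph is monochromatic. -/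
theorem mt_sort_union (F H : Finset ℕ) (h : FinsetLT F H) :
    (F ∪ H).sort (· ≤ ·) = F.sort (· ≤ ·) ++ H.sort (· ≤ ·) := by
  have hs : (F.sort (· ≤ ·) ++ H.sort (· ≤ ·)).Pairwise (· < ·) := by
    rw [List.pairwise_append]
    refine ⟨F.sortedLT_sort.pairwise, H.sortedLT_sort.pairwise, ?_⟩
    intro i hi j hj
    exact h i (by simpa using hi) j (by simpa using hj)
  have hn : (F.sort (· ≤ ·) ++ H.sort (· ≤ ·)).Nodup := hs.imp (fun h => ne_of_lt h)
  refine List.Perm.eq_of_pairwise (le := (· ≤ ·)) (fun a b _ _ => le_antisymm) ?_ ?_ ?_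
  · exact (F ∪ H).pairwise_sort (· ≤ ·)
  · exact hs.imp le_of_lt
  · rw [List.perm_ext_iff_of_nodup ((F ∪ H).sort_nodup (· ≤ ·)) hn]
    intro x
    simp

theorem mt_fsum_union {S : Type*} [AddSemigroup S] (a : ℕ → S) (F H : Finset ℕ)
    (hF : F.Nonempty) (hH : H.Nonempty) (h : FinsetLT F H) :
    fsum a (F ∪ H) = fsum a F + fsum a H := by
  have e1 : ∃ x xs, (F.sort (· ≤ ·)).map a = x :: xs := by
    cases hc : (F.sort (· ≤ ·)).map a with
    | nil =>
      have := congrArg List.length hc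
      simp at this
      simp [this] at hF
    | cons x xs => exact ⟨x, xs, rfl⟩
  have e2 : ∃ x xs, (H.sort (· ≤ ·)).map a = x :: xs := by
    cases hc : (H.sort (· ≤ ·)).map a with
    | nil =>
      have := congrArg List.length hc
      simp at this
      simp [this] at hH
    | cons x xs => exact ⟨x, xs, rfl⟩
  obtain ⟨x, xs, hx⟩ := e1
  obtain ⟨y, ys, hy⟩ := e2
  have key : ∀ (l : List S) (u v : S), l.foldl (· + ·) (u + v) = u + l.foldl (· + ·) v := by
    intro l
    induction l with
    | nil => intros; rfl
    | cons z l ih => intro u v; simp only [List.foldl_cons]; rw [add_assoc, ih]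
  unfold fsum
  rw [mt_sort_union F H h, List.map_append, hx, hy]
  simp only [List.cons_append, List.foldl_append, List.foldl_cons]
  rw [key]

theorem mt_fsum_singleton {S : Type*} [AddSemigroup S] (a : ℕ → S) (n : ℕ) :
    fsum a {n} = a n := by
  simp [fsum]

theorem mt_chain (E : ℕ → Finset ℕ) (hn : ∀ n, (E n).Nonempty)
    (hE : ∀ n, FinsetLT (E n) (E (n + 1))) : ∀ m n, m < n → FinsetLT (E m) (E n) := by
  intro m n hmn
  induction n, hmn using Nat.le_induction with
  | base => exact hE m
  | succ k _ ih =>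
    intro i hi j hj
    obtain ⟨l, hl⟩ := hn k
    exact (ih i hi l hl).trans (hE k l hl j hj)

theorem mt_biUnion_lt (E : ℕ → Finset ℕ) (hE : ∀ m n, m < n → FinsetLT (E m) (E n))
    (G H : Finset ℕ) (h : FinsetLT G H) : FinsetLT (G.biUnion E) (H.biUnion E) := by
  intro i hi j hj
  simp only [Finset.mem_biUnion] at hi hj
  obtain ⟨m, hm, hi⟩ := hi
  obtain ⟨n, hn, hj⟩ := hj
  exact hE m n (h m hm n hn) i hi j hj

theorem mt_fsum_biUnion {S : Type*} [AddSemigroup S] (a : ℕ → S) (E : ℕ → Finset ℕ)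
    (hn : ∀ n, (E n).Nonempty) (hE : ∀ m n, m < n → FinsetLT (E m) (E n)) (G : Finset ℕ)
    (hG : G.Nonempty) :
    fsum (fun n => fsum a (E n)) G = fsum a (G.biUnion E) := by
  induction G using Finset.induction_on_max with
  | empty => simp at hG
  | insert m G hm ih =>
    rcases G.eq_empty_or_nonempty with rfl | hG'
    · simp [mt_fsum_singleton]
    · have hlt : FinsetLT G {m} := by
        intro i hi j hj
        rw [Finset.mem_singleton] at hj
        exact hj ▸ hm i hi
      have e : insert m G = G ∪ {m} := by
        ext; simp [or_comm]
      rw [e, mt_fsum_union _ _ _ hG' (by simp) hlt, ih hG', Finset.union_biUnion,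
        mt_fsum_union, mt_fsum_singleton, Finset.singleton_biUnion]
      · exact hG'.biUnion fun i _ => hn i
      · simpa using hn m
      · exact mt_biUnion_lt E hE _ _ hlt

/-- Union as a semigroup operation. -/
@[reducible] def mtSemigroup : Semigroup (Finset ℕ) where
  mul F H := F ∪ H
  mul_assoc F G H := Finset.union_assoc F G H

section
attribute [local instance] mtSemigroup Ultrafilter.semigroup

theorem mt_idem : ∃ U : Ultrafilter (Finset ℕ),
    (∀ N : ℕ, ∀ᶠ F in (U : Filter (Finset ℕ)), F.Nonempty ∧ ∀ i ∈ F, N ≤ i) ∧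
    ∀ p : Finset ℕ → Prop, (∀ᶠ F in (U : Filter (Finset ℕ)), p F) →
      ∀ᶠ F in (U : Filter (Finset ℕ)), ∀ᶠ H in (U : Filter (Finset ℕ)), p (F ∪ H) := by
  let T : Set (Ultrafilter (Finset ℕ)) :=
    ⋂ N : ℕ, {U | {F : Finset ℕ | F.Nonempty ∧ ∀ i ∈ F, N ≤ i} ∈ U}
  have h := exists_idempotent_in_compact_subsemigroup
    (Ultrafilter.continuous_mul_left (M := Finset ℕ)) T ?_ ?_ ?_
  · obtain ⟨U, hU, hi⟩ := h
    refine ⟨U, fun N => Set.mem_iInter.mp hU N, ?_⟩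
    intro p hp
    rw [← hi, Ultrafilter.eventually_mul] at hp
    exact hp
  · refine ⟨(Filter.hyperfilter ℕ).map (fun n => {n}), ?_⟩
    rw [Set.mem_iInter]
    intro N
    change _ ∈ Ultrafilter.map _ _
    rw [Ultrafilter.mem_map]
    apply Filter.mem_hyperfilter_of_finite_compl
    apply (Set.finite_lt_nat N).subset
    intro x hx
    simpa using hx
  · exact IsClosed.isCompact (isClosed_iInter fun i => ultrafilter_isClosed_basic _)
  · intro U hU V hV
    rw [Set.mem_iInter] at *
    intro N
    change ∀ᶠ F in ((U * V : Ultrafilter (Finset ℕ)) : Filter (Finset ℕ)),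
      F.Nonempty ∧ ∀ i ∈ F, N ≤ i
    rw [Ultrafilter.eventually_mul]
    filter_upwards [hU N] with F hF
    filter_upwards [hV N] with H hH
    change (F ∪ H).Nonempty ∧ ∀ i ∈ F ∪ H, N ≤ i
    refine ⟨hF.1.mono Finset.subset_union_left, ?_⟩
    intro i hi
    rcases Finset.mem_union.mp hi with h | h
    · exact hF.2 i h
    · exact hH.2 i h
end

theorem mt_color (U : Ultrafilter (Finset ℕ)) {r : ℕ} (f : Finset ℕ → Fin r) :
    ∃ c, ∀ᶠ F in (U : Filter (Finset ℕ)), f F = c := by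
  by_contra! h
  have h' : ∀ c, ∀ᶠ F in (U : Filter (Finset ℕ)), f F ≠ c := h
  obtain ⟨F, hF⟩ := (Filter.eventually_all.mpr h').exists
  exact hF (f F) rfl

theorem mt_finite {r : ℕ} (φ : Finset ℕ → Finset ℕ → Fin r) :
    ∃ F : ℕ → Finset ℕ, (∀ n, (F n).Nonempty) ∧ (∀ n, FinsetLT (F n) (F (n + 1))) ∧
      ∃ c, ∀ G H : Finset ℕ, G.Nonempty → H.Nonempty → FinsetLT G H →
        φ (G.biUnion F) (H.biUnion F) = c := by
  obtain ⟨U, hU, hid⟩ := mt_idem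
  choose c₁ hc₁ using fun X => mt_color U (φ X)
  obtain ⟨c, hc⟩ := mt_color U c₁
  let D : ℕ → Set (Finset ℕ) := fun N =>
    {H | (H.Nonempty ∧ ∀ i ∈ H, N ≤ i) ∧ ∀ X ∈ (Finset.range N).powerset, c₁ X = c → φ X H = c}
  have hD : ∀ N, D N ∈ U := by
    intro N
    refine Filter.Eventually.and (hU N) ?_
    rw [Filter.eventually_all_finset]
    intro X _
    by_cases hX : c₁ X = c
    · filter_upwards [hc₁ X] with H hH _
      exact hH.trans hX
    · exact Filter.Eventually.of_forall fun H h => absurd h hX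
  have ex : ∀ s : {s : Set (Finset ℕ) // s ∈ U}, ∃ F, F ∈ s.1 ∧ {H | F ∪ H ∈ s.1} ∈ U := by
    intro s
    have h1 : ∀ᶠ F in (U : Filter (Finset ℕ)), F ∈ s.1 := s.2
    exact (h1.and (hid _ h1)).exists
  choose el hel1 hel2 using ex
  let nx : {s : Set (Finset ℕ) // s ∈ U} → {s : Set (Finset ℕ) // s ∈ U} := fun s =>
    ⟨(s.1 ∩ {H | el s ∪ H ∈ s.1}) ∩ D ((el s).sup id + 1),
      Filter.inter_mem (Filter.inter_mem s.2 (hel2 s)) (hD _)⟩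
  let s : ℕ → {s : Set (Finset ℕ) // s ∈ U} := fun n =>
    Nat.rec ⟨{X | c₁ X = c} ∩ D 0, Filter.inter_mem hc (hD 0)⟩ (fun _ p => nx p) n
  have hs0 : (s 0).1 = {X | c₁ X = c} ∩ D 0 := rfl
  have hss : ∀ n, (s (n + 1)).1 =
      ((s n).1 ∩ {H | el (s n) ∪ H ∈ (s n).1}) ∩ D ((el (s n)).sup id + 1) := fun n => rfl
  have hanti : ∀ m n, m ≤ n → (s n).1 ⊆ (s m).1 := by
    intro m n hmn
    induction n, hmn using Nat.le_induction with
    | base => exact subset_rfl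
    | succ k _ ih =>
      rw [hss]
      exact fun x hx => ih hx.1.1
  let F : ℕ → Finset ℕ := fun n => el (s n)
  have hFs : ∀ n, F n ∈ (s n).1 := fun n => hel1 _
  have hFn : ∀ n, (F n).Nonempty := by
    intro n
    have := hanti 0 n (Nat.zero_le _) (hFs n)
    rw [hs0] at this
    exact this.2.1.1
  have hFlt : ∀ n, FinsetLT (F n) (F (n + 1)) := by
    intro n i hi j hj
    have := hFs (n + 1)
    rw [hss] at this
    have h2 := this.2.1.2 j hj
    have h3 : i ≤ (F n).sup id := Finset.le_sup (f := id) hi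
    exact Nat.lt_of_lt_of_le (Nat.lt_succ_of_le h3) h2
  have hch := mt_chain F hFn hFlt
  have hun : ∀ G : Finset ℕ, G.Nonempty → ∀ n, (∀ i ∈ G, n ≤ i) → G.biUnion F ∈ (s n).1 := by
    intro G
    induction G using Finset.induction_on_min with
    | empty => intro h; simp at h
    | insert m G hm ih =>
      intro _ n hn
      apply hanti n m (hn m (by simp))
      rcases G.eq_empty_or_nonempty with rfl | hG'
      · simpa using hFs m
      · have := ih hG' (m + 1) hm
        rw [hss] at this
        rw [Finset.biUnion_insert]
        exact this.1.2
  refine ⟨F, hFn, hFlt, c, ?_⟩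
  intro G H hG hH hlt
  have h1 := hun G hG 0 (by simp)
  have h2 := hun H hH (G.max' hG + 1) (fun i hi => hlt _ (G.max'_mem hG) i hi)
  rw [hss] at h2
  rw [hs0] at h1
  refine h2.2.2 _ ?_ h1.1
  rw [Finset.mem_powerset]
  intro i hi
  rw [Finset.mem_biUnion] at hi
  obtain ⟨m, hm, hi⟩ := hi
  rw [Finset.mem_range, Nat.lt_succ_iff]
  have h3 : ∀ j ∈ F (G.max' hG), j ≤ (F (G.max' hG)).sup id :=
    fun j hj => Finset.le_sup (f := id) hj
  rcases (G.le_max' m hm).eq_or_lt with h | h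
  · exact h3 i (h ▸ hi)
  · obtain ⟨j, hj⟩ := hFn (G.max' hG)
    exact (hch _ _ h i hi j hj).le.trans (h3 j hj)


/-- **Milliken–Taylor Theorem in arbitrary semigroups.** If a sequence `a` in a semigroup `S`
has a proper sumsequence, then for each finite coloring of the 2-element subsets of `S`
there is a proper sumsequence of `a` whose sum graph is monochromatic. -/
theorem milliken_taylor_semigroup {S : Type*} [AddSemigroup S] (a : ℕ → S)
    (h : ∃ b : ℕ → S, IsSumSeq a b ∧ IsProper b)
    (r : ℕ) (χ : Sym2 S → Fin r) :
    ∃ b : ℕ → S, IsSumSeq a b ∧ IsProper b ∧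
      ∃ c : Fin r, ∀ F H : Finset ℕ, F.Nonempty → H.Nonempty → FinsetLT F H →
        χ s(fsum b F, fsum b H) = c := by
  obtain ⟨b, ⟨E, hEn, hElt, hb⟩, hp⟩ := h
  obtain ⟨F, hFn, hFlt, c, hc⟩ := mt_finite (fun X Y => χ s(fsum b X, fsum b Y))
  have hEc := mt_chain E hEn hElt
  have hFc := mt_chain F hFn hFlt
  obtain rfl : b = fun n => fsum a (E n) := funext hb
  refine ⟨fun n => fsum (fun n => fsum a (E n)) (F n),
    ⟨fun n => (F n).biUnion E, fun n => (hFn n).biUnion fun i _ => hEn i,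
      fun n => mt_biUnion_lt E hEc _ _ (hFlt n),
      fun n => mt_fsum_biUnion a E hEn hEc _ (hFn n)⟩, ?_, c, ?_⟩
  · intro G H hG hH hlt
    rw [mt_fsum_biUnion _ F hFn hFc G hG, mt_fsum_biUnion _ F hFn hFc H hH]
    exact hp _ _ (hG.biUnion fun i _ => hFn i) (hH.biUnion fun i _ => hFn i)
      (mt_biUnion_lt F hFc _ _ hlt)
  · intro G H hG hH hlt
    rw [mt_fsum_biUnion _ F hFn hFc G hG, mt_fsum_biUnion _ F hFn hFc H hH]
    exact hc G H hG hH hlt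
end

section
/- Let S be a semigroup and a₁,a₂,… a sequence in S. If the sequence (aₙ) has no proper sumsequence, then every sumsequence of (aₙ) has a sumsequence of the form e,e,e,…, where e is an idempotent element of S (e + e = e); equivalently, a sumsequence whose set of finite sums is a singleton. -/
theorem fsum_singleton' {S : Type*} [AddSemigroup S] (a : ℕ → S) (i : ℕ) :
    fsum a {i} = a i := by
  simp [fsum]

theorem foldl_append_add {S : Type*} [AddSemigroup S] (x y : S) (l m : List S) :
    (l ++ y :: m).foldl (· + ·) x = l.foldl (· + ·) x + m.foldl (· + ·) y := by
  rw [List.foldl_append, List.foldl_cons]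
  generalize l.foldl (· + ·) x = z
  induction m using List.reverseRecOn with
  | nil => rfl
  | append_singleton m w ih => simp only [List.foldl_append, List.foldl_cons, List.foldl_nil, ih, add_assoc]

theorem sort_union {F H : Finset ℕ} (hlt : FinsetLT F H) :
    (F ∪ H).sort (· ≤ ·) = F.sort (· ≤ ·) ++ H.sort (· ≤ ·) := by
  have hd : Disjoint F H := by
    rw [Finset.disjoint_left]
    intro i hi hj
    exact lt_irrefl _ (hlt i hi i hj)
  have hp : ((F ∪ H).sort (· ≤ ·)).Perm (F.sort (· ≤ ·) ++ H.sort (· ≤ ·)) := by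
    rw [← Multiset.coe_eq_coe, ← Multiset.coe_add]
    simp only [Finset.sort_eq]
    rw [← Finset.disjUnion_eq_union _ _ hd]
    rfl
  refine hp.eq_of_pairwise (le := (· ≤ ·)) (fun _ _ _ _ h1 h2 => le_antisymm h1 h2) (Finset.pairwise_sort _ _) ?_
  rw [List.pairwise_append]
  refine ⟨Finset.pairwise_sort _ _, Finset.pairwise_sort _ _, ?_⟩
  intro x hx y hy
  exact (hlt x (by simpa using hx) y (by simpa using hy)).le

theorem fsum_union {S : Type*} [AddSemigroup S] (a : ℕ → S) {F H : Finset ℕ}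
    (hF : F.Nonempty) (hH : H.Nonempty) (hlt : FinsetLT F H) :
    fsum a (F ∪ H) = fsum a F + fsum a H := by
  unfold fsum
  rw [sort_union hlt, List.map_append]
  have h1 : (F.sort (· ≤ ·)).map a ≠ [] := by
    intro h
    have := congrArg List.length h
    simp at this
    exact hF.ne_empty this
  have h2 : (H.sort (· ≤ ·)).map a ≠ [] := by
    intro h
    have := congrArg List.length h
    simp at this
    exact hH.ne_empty this
  generalize (F.sort (· ≤ ·)).map a = l at *
  generalize (H.sort (· ≤ ·)).map a = m at *
  cases l with
  | nil => exact absurd rfl h1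
  | cons x l =>
    cases m with
    | nil => exact absurd rfl h2
    | cons y m => exact foldl_append_add x y l m

theorem lt_of_chain {F : ℕ → Finset ℕ} (hne : ∀ n, (F n).Nonempty)
    (hlt : ∀ n, FinsetLT (F n) (F (n + 1))) {m n : ℕ} (hmn : m < n) : FinsetLT (F m) (F n) := by
  induction n, hmn using Nat.le_induction with
  | base => exact hlt m
  | succ n _ ih =>
    intro i hi j hj
    obtain ⟨k, hk⟩ := hne n
    exact (ih i hi k hk).trans (hlt n k hk j hj)

theorem fsum_biUnion {S : Type*} [AddSemigroup S] {a b : ℕ → S} {F : ℕ → Finset ℕ}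
    (hne : ∀ n, (F n).Nonempty) (hlt : ∀ n, FinsetLT (F n) (F (n + 1)))
    (hb : ∀ n, b n = fsum a (F n)) (G : Finset ℕ) (hG : G.Nonempty) :
    fsum b G = fsum a (G.biUnion F) := by
  induction G using Finset.induction_on_min with
  | empty => exact absurd hG Finset.not_nonempty_empty
  | insert m s hm ih =>
    rcases s.eq_empty_or_nonempty with rfl | hs
    · simp [fsum_singleton', hb]
    · rw [Finset.insert_eq, fsum_union b (Finset.singleton_nonempty m) hs, ih hs, fsum_singleton', hb,
        Finset.union_biUnion, Finset.singleton_biUnion, fsum_union a (hne m)]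
      · exact hs.biUnion (fun i _ => hne i)
      · intro i hi j hj
        obtain ⟨k, hk, hj⟩ := Finset.mem_biUnion.1 hj
        exact lt_of_chain hne hlt (hm k hk) i hi j hj
      · intro i hi j hj
        rw [Finset.mem_singleton] at hi
        subst hi
        exact hm j hj

theorem IsSumSeq.comp {S : Type*} [AddSemigroup S] {a b c : ℕ → S}
    (hab : IsSumSeq a b) (hbc : IsSumSeq b c) : IsSumSeq a c := by
  obtain ⟨F, hF, hFl, hb⟩ := hab
  obtain ⟨G, hG, hGl, hc⟩ := hbc
  refine ⟨fun n => (G n).biUnion F, fun n => (hG n).biUnion (fun i _ => hF i), ?_, ?_⟩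
  · intro n i hi j hj
    obtain ⟨k, hk, hi⟩ := Finset.mem_biUnion.1 hi
    obtain ⟨l, hl, hj⟩ := Finset.mem_biUnion.1 hj
    exact lt_of_chain hF hFl (hGl n k hk l hl) i hi j hj
  · intro n
    rw [hc, fsum_biUnion hF hFl hb _ (hG n)]

attribute [local instance] Ultrafilter.add Ultrafilter.addSemigroup

theorem exists_idem_fs {S : Type*} [AddSemigroup S] (b : ℕ → S) :
    ∃ U : Ultrafilter S, U + U = U ∧ ∀ n, FStail b n ∈ U := by
  let T : Set (Ultrafilter S) := ⋂ n, { U | FStail b n ∈ U }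
  have h := exists_idempotent_in_compact_add_subsemigroup (M := Ultrafilter S) ?_ T ?_ ?_ ?_
  · obtain ⟨U, hU, hi⟩ := h
    exact ⟨U, hi, fun n => Set.mem_iInter.mp hU n⟩
  · exact Ultrafilter.continuous_add_left
  · apply IsCompact.nonempty_iInter_of_sequence_nonempty_isCompact_isClosed
    · intro n U hU
      refine Filter.mem_of_superset (show FStail b (n + 1) ∈ (U : Filter S) from hU) ?_
      rintro s ⟨F, hF, hn, rfl⟩
      exact ⟨F, hF, fun i hi => (Nat.le_succ n).trans (hn i hi), rfl⟩
    · intro n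
      exact ⟨pure (b n), Filter.mem_pure.mpr ⟨{n}, by simp, by simp, fsum_singleton' b n⟩⟩
    · exact (ultrafilter_isClosed_basic _).isCompact
    · intro n
      apply ultrafilter_isClosed_basic
  · exact IsClosed.isCompact (isClosed_iInter fun i => ultrafilter_isClosed_basic _)
  · intro U hU V hV
    rw [Set.mem_iInter] at *
    intro n
    change ∀ᶠ m in ((U + V : Ultrafilter S) : Filter S), m ∈ FStail b n
    rw [Ultrafilter.eventually_add]
    have hUn : FStail b n ∈ (U : Filter S) := hU n
    filter_upwards [hUn] with m hm
    obtain ⟨F, hF, hn, rfl⟩ := hm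
    have hVn : FStail b (n + F.sup id + 1) ∈ (V : Filter S) := hV _
    filter_upwards [hVn] with m' hm'
    obtain ⟨H, hH, hn', rfl⟩ := hm'
    refine ⟨F ∪ H, hF.mono Finset.subset_union_left, ?_, fsum_union b hF hH ?_⟩
    · intro i hi
      rcases Finset.mem_union.1 hi with hi | hi
      · exact hn i hi
      · have := hn' i hi
        omega
    · intro i hi j hj
      have h1 := hn' j hj
      have h2 : i ≤ F.sup id := Finset.le_sup (f := id) hi
      omega

theorem exists_proper {S : Type*} [AddSemigroup S] (b : ℕ → S) (U : Ultrafilter S)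
    (hU : U + U = U) (hb : ∀ n, FStail b n ∈ U) (hnp : ∀ e : S, {e} ∉ U) :
    ∃ c, IsSumSeq b c ∧ IsProper c := by
  have step : ∀ p : {D : Set S // D ∈ U} × ℕ, ∃ F : Finset ℕ, F.Nonempty ∧ (∀ i ∈ F, p.2 ≤ i) ∧
      fsum b F ∈ p.1.1 ∧ {m | fsum b F + m ∈ p.1.1} ∈ U := by
    rintro ⟨⟨D, hD⟩, k⟩
    have h1 : {m | {m' | m + m' ∈ D} ∈ U} ∈ U := by
      have := hD
      rw [← hU] at this
      exact this
    obtain ⟨x, ⟨hx1, hx2⟩, F, hF, hk, rfl⟩ :=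
      U.nonempty_of_mem (Filter.inter_mem (Filter.inter_mem hD h1) (hb k))
    exact ⟨F, hF, hk, hx1, hx2⟩
  choose f hf1 hf2 hf3 hf4 using step
  have hfin : ∀ A : Set S, A.Finite → Aᶜ ∈ U := by
    intro A hA
    rw [Ultrafilter.compl_mem_iff_notMem]
    intro hAU
    obtain ⟨x, _, hx⟩ := (Ultrafilter.eq_pure_of_finite_mem hA hAU)
    exact hnp x (by rw [hx]; exact Filter.mem_pure.mpr rfl)
  let A : ℕ → Set S := fun k => fsum b '' ((Finset.range k).powerset : Set (Finset ℕ))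
  have hA : ∀ k, (A k)ᶜ ∈ U := fun k => hfin _ ((Finset.finite_toSet _).image _)
  let next : {D : Set S // D ∈ U} × ℕ → {D : Set S // D ∈ U} × ℕ := fun p =>
    (⟨(p.1.1 ∩ {m | fsum b (f p) + m ∈ p.1.1}) ∩ (A ((f p).sup id + 1))ᶜ,
      Filter.inter_mem (Filter.inter_mem p.1.2 (hf4 p)) (hA _)⟩, (f p).sup id + 1)
  let P : ℕ → {D : Set S // D ∈ U} × ℕ := fun n =>
    Nat.rec (⟨Set.univ, Filter.univ_mem⟩, 0) (fun _ p => next p) n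
  have hP : ∀ n, P (n + 1) = next (P n) := fun n => rfl
  let F : ℕ → Finset ℕ := fun n => f (P n)
  let c : ℕ → S := fun n => fsum b (F n)
  have hFne : ∀ n, (F n).Nonempty := fun n => hf1 _
  have hFub : ∀ n, ∀ i ∈ F n, i < (P (n + 1)).2 := by
    intro n i hi
    have : i ≤ (F n).sup id := Finset.le_sup (f := id) hi
    exact Nat.lt_succ_of_le this
  have hFl : ∀ n, FinsetLT (F n) (F (n + 1)) := by
    intro n i hi j hj
    exact (hFub n i hi).trans_le (hf2 _ j hj)
  have hkmono : Monotone (fun n => (P n).2) := by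
    refine monotone_nat_of_le_succ fun n => ?_
    obtain ⟨i, hi⟩ := hFne n
    exact (hf2 _ i hi).trans (hFub n i hi).le
  have hDanti : Antitone (fun n => (P n).1.1) := by
    refine antitone_nat_of_succ_le fun n => ?_
    intro x hx
    exact hx.1.1
  have key : ∀ H : Finset ℕ, H.Nonempty → ∀ n, (∀ i ∈ H, n ≤ i) → fsum c H ∈ (P n).1.1 := by
    intro H
    induction H using Finset.induction_on_min with
    | empty => intro hG; exact absurd hG Finset.not_nonempty_empty
    | insert m s hm ih =>
      intro _ n hn
      refine hDanti (hn m (Finset.mem_insert_self _ _)) ?_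
      rcases s.eq_empty_or_nonempty with rfl | hs
      · simp only [insert_empty_eq, fsum_singleton']
        exact hf3 _
      · have h1 := ih hs (m + 1) (fun i hi => hm i hi)
        rw [Finset.insert_eq, fsum_union c (Finset.singleton_nonempty m) hs, fsum_singleton']
        · exact h1.1.2
        · intro i hi j hj
          rw [Finset.mem_singleton] at hi
          subst hi
          exact hm j hj
  refine ⟨c, ⟨F, hFne, hFl, fun n => rfl⟩, ?_⟩
  intro G H hG hH hlt heq
  have h1 := key H hH (G.sup id + 1) (fun i hi => by
    obtain ⟨j, hj, hj'⟩ := Finset.exists_mem_eq_sup G hG id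
    rw [hj']
    exact hlt j hj i hi)
  refine h1.2 ?_
  rw [← heq, fsum_biUnion hFne hFl (fun n => rfl) G hG]
  refine ⟨G.biUnion F, ?_, rfl⟩
  rw [Finset.mem_coe, Finset.mem_powerset]
  intro i hi
  obtain ⟨j, hj, hi⟩ := Finset.mem_biUnion.1 hi
  have h2 : j ≤ G.sup id := Finset.le_sup (f := id) hj
  rw [Finset.mem_range]
  exact (hFub j i hi).trans_le (hkmono (Nat.succ_le_succ h2))

/-- If a sequence `a` in a semigroup `S` has no proper sumsequence, then every sumsequence
of `a` has a sumsequence of the form `e, e, e, …` with `e` idempotent; equivalently, a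
sumsequence whose set of finite sums is the singleton `{e}`. -/
theorem sumseq_of_no_proper_sumseq {S : Type*} [AddSemigroup S] (a : ℕ → S)
    (h : ¬∃ b : ℕ → S, IsSumSeq a b ∧ IsProper b) :
    ∀ b : ℕ → S, IsSumSeq a b →
      ∃ c : ℕ → S, IsSumSeq b c ∧ ∃ e : S, e + e = e ∧ (∀ n, c n = e) ∧ FSset c = {e} := by
  
  intro b hab
  obtain ⟨U, hU, hb⟩ := exists_idem_fs b
  by_cases hnp : ∀ e : S, {e} ∉ U
  · obtain ⟨c, hbc, hc⟩ := exists_proper b U hU hb hnp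
    exact absurd ⟨c, hab.comp hbc, hc⟩ h
  push Not at hnp
  obtain ⟨e, he⟩ := hnp
  have hee : e + e = e := by
    have h1 : {m | {m' | m + m' ∈ ({e} : Set S)} ∈ U} ∈ U := by
      have := he
      rw [← hU] at this
      exact this
    obtain ⟨x, hx, hx'⟩ := U.nonempty_of_mem (Filter.inter_mem h1 he)
    obtain ⟨y, hy, hy'⟩ := U.nonempty_of_mem (Filter.inter_mem hx he)
    rw [Set.mem_singleton_iff] at hx' hy'
    subst hx'
    subst hy'
    exact hy
  have hex : ∀ n, ∃ F : Finset ℕ, F.Nonempty ∧ (∀ i ∈ F, n ≤ i) ∧ fsum b F = e := by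
    intro n
    obtain ⟨x, hx, hx'⟩ := U.nonempty_of_mem (Filter.inter_mem (hb n) he)
    rw [Set.mem_singleton_iff] at hx'
    subst hx'
    exact hx
  choose f hf1 hf2 hf3 using hex
  let k : ℕ → ℕ := fun n => Nat.rec 0 (fun _ k => (f k).sup id + 1) n
  refine ⟨fun _ => e, ⟨fun n => f (k n), fun n => hf1 _, ?_, fun n => (hf3 _).symm⟩, e, hee,
    fun _ => rfl, ?_⟩
  · intro n i hi j hj
    have h1 : (f (k n)).sup id + 1 ≤ j := hf2 (k (n + 1)) j hj
    have h2 : i ≤ (f (k n)).sup id := Finset.le_sup (f := id) hi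
    omega
  · have hall : ∀ F : Finset ℕ, F.Nonempty → fsum (fun _ => e) F = e := by
      intro F
      induction F using Finset.induction_on_min with
      | empty => intro hG; exact absurd hG Finset.not_nonempty_empty
      | insert m s hm ih =>
        intro _
        rcases s.eq_empty_or_nonempty with rfl | hs
        · simp [fsum_singleton']
        · rw [Finset.insert_eq, fsum_union _ (Finset.singleton_nonempty m) hs, fsum_singleton', ih hs,
            hee]
          intro i hi j hj
          rw [Finset.mem_singleton] at hi
          subst hi
          exact hm j hj
    ext s
    constructor
    · rintro ⟨F, hF, rfl⟩
      exact hall F hF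
    · rintro rfl
      exact ⟨{0}, by simp, hall _ (by simp)⟩
end

section
/- Let S be a semigroup. (1) For each free idempotent filter ℱ on S, the family ℱ⁺ is an idempotent superfilter on S. (2) For each idempotent superfilter 𝒜 on S, the family 𝒜⁺ is a free idempotent filter on S. -/
/-- `A⋆(ℱ) = {b : ∃ C ∈ ℱ, b + C ⊆ A}`. -/
def starSet {S : Type*} [Add S] (A : Set S) (ℱ : Set (Set S)) : Set S :=
  {b | ∃ C ∈ ℱ, ∀ c ∈ C, b + c ∈ A}

/-- A (proper) filter of subsets of `S`, as a family of sets. -/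
def IsFilterFam {S : Type*} (ℱ : Set (Set S)) : Prop :=
  Set.univ ∈ ℱ ∧ ∅ ∉ ℱ ∧ (∀ A ∈ ℱ, ∀ B : Set S, A ⊆ B → B ∈ ℱ) ∧
    ∀ A ∈ ℱ, ∀ B ∈ ℱ, A ∩ B ∈ ℱ

/-- A superfilter on `S`: a (nonempty) family of infinite sets, upward closed,
such that whenever a union of two sets belongs to it, one of them does. -/
def IsSuperfilter {S : Type*} (𝒜 : Set (Set S)) : Prop :=
  Set.univ ∈ 𝒜 ∧ (∀ A ∈ 𝒜, A.Infinite) ∧ (∀ A ∈ 𝒜, ∀ B : Set S, A ⊆ B → B ∈ 𝒜) ∧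
    ∀ A B : Set S, A ∪ B ∈ 𝒜 → A ∈ 𝒜 ∨ B ∈ 𝒜

/-- `ℱ⁺ = {A : S ∖ A ∉ ℱ}`. -/
def plusFam {S : Type*} (ℱ : Set (Set S)) : Set (Set S) := {A | Aᶜ ∉ ℱ}

/-- (1) For each free idempotent filter `ℱ` on a semigroup `S`, the family `ℱ⁺` is an
idempotent superfilter; (2) for each idempotent superfilter `𝒜` on `S`, the family `𝒜⁺`
is a free idempotent filter. -/
theorem plus_idempotent {S : Type*} [AddSemigroup S] :
    (∀ ℱ : Set (Set S), IsFilterFam ℱ → ⋂₀ ℱ = ∅ → (∀ A ∈ ℱ, starSet A ℱ ∈ ℱ) →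
      IsSuperfilter (plusFam ℱ) ∧
        ∀ A : Set S, starSet A (plusFam ℱ) ∈ plusFam ℱ → A ∈ plusFam ℱ) ∧
    (∀ 𝒜 : Set (Set S), IsSuperfilter 𝒜 → (∀ A : Set S, starSet A 𝒜 ∈ 𝒜 → A ∈ 𝒜) →
      IsFilterFam (plusFam 𝒜) ∧ ⋂₀ (plusFam 𝒜) = ∅ ∧
        ∀ A ∈ plusFam 𝒜, starSet A (plusFam 𝒜) ∈ plusFam 𝒜) := by
  constructor
  · rintro ℱ ⟨hu, he, hup, hi⟩ hfree hid
    have hfin : ∀ A : Set S, A.Finite → Aᶜ ∈ ℱ := by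
      intro A hA
      induction A, hA using Set.Finite.induction_on with
      | empty => simpa using hu
      | @insert a s _ _ ih =>
        have h1 : a ∉ ⋂₀ ℱ := by rw [hfree]; simp
        simp only [Set.mem_sInter, not_forall] at h1
        obtain ⟨C, hC, haC⟩ := h1
        refine hup _ (hi _ hC _ ih) _ ?_
        rintro x ⟨hx, hxs⟩ (rfl | h)
        · exact haC hx
        · exact hxs h
    refine ⟨⟨?_, ?_, ?_, ?_⟩, ?_⟩
    · change Set.univᶜ ∉ ℱ
      simpa using he
    · intro A hA hf
      exact hA (hfin A hf)
    · intro A hA B hAB hB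
      exact hA (hup _ hB _ (Set.compl_subset_compl.2 hAB))
    · intro A B hAB
      by_contra h
      rw [not_or] at h
      have hA : Aᶜ ∈ ℱ := not_not.1 h.1
      have hB : Bᶜ ∈ ℱ := not_not.1 h.2
      apply hAB
      rw [Set.compl_union]
      exact hi _ hA _ hB
    · intro A hA hc
      refine hA (hup _ (hid _ hc) _ ?_)
      rintro b ⟨C, hC, hbC⟩ ⟨D, hD, hbD⟩
      exact hD (hup _ hC _ fun c hc hd => hbC c hc (hbD c hd))
  · rintro 𝒜 ⟨hu, hinf, hup, hun⟩ hid
    refine ⟨⟨?_, ?_, ?_, ?_⟩, ?_, ?_⟩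
    · intro h
      exact hinf _ h (by simp)
    · intro h
      exact h (by simpa using hu)
    · intro A hA B hAB hB
      exact hA (hup _ hB _ (Set.compl_subset_compl.2 hAB))
    · intro A hA B hB h
      rw [Set.compl_inter] at h
      exact (hun _ _ h).elim hA hB
    · rw [Set.eq_empty_iff_forall_notMem]
      intro x hx
      refine hx {x}ᶜ (fun h => ?_) rfl
      exact hinf _ h (by simp)
    · intro A hA h
      refine hA (hid _ (hup _ h _ ?_))
      intro b hb
      refine ⟨{c | b + c ∈ A}ᶜ, ?_, fun c hc => hc⟩
      by_contra hC
      exact hb ⟨_, hC, fun c hc => hc⟩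
end

section
/- Let S be a semigroup and ℱ a free idempotent filter on S. Then the set T := {p ∈ βS : ℱ ⊆ p} is a closed subsemigroup of βS disjoint from S; that is, T is nonempty, topologically closed in βS, every ultrafilter in T is free, and p + q ∈ T for all p, q ∈ T. -/
attribute [local instance] Ultrafilter.add Ultrafilter.addSemigroup

/-- For a free idempotent filter `ℱ` on a semigroup `S`, the set `T = {p ∈ βS : ℱ ⊆ p}`
is a closed subsemigroup of `βS` disjoint from `S`: `T` is nonempty, closed, consists of
nonprincipal ultrafilters, and is closed under the addition of ultrafilters. -/
theorem free_idem_filter_closed_subsemigroup {S : Type*} [AddSemigroup S]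
    (ℱ : Set (Set S)) (hℱ : IsFilterFam ℱ) (hfree : ⋂₀ ℱ = ∅)
    (hidem : ∀ A ∈ ℱ, starSet A ℱ ∈ ℱ) :
    {p : Ultrafilter S | ∀ A ∈ ℱ, A ∈ p}.Nonempty ∧
    IsClosed {p : Ultrafilter S | ∀ A ∈ ℱ, A ∈ p} ∧
    (∀ p : Ultrafilter S, (∀ A ∈ ℱ, A ∈ p) → ∀ x : S, p ≠ pure x) ∧
    ∀ p q : Ultrafilter S, (∀ A ∈ ℱ, A ∈ p) → (∀ A ∈ ℱ, A ∈ q) →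
      ∀ A ∈ ℱ, A ∈ p + q := by
  obtain ⟨h1, h2, h3, h4⟩ := hℱ
  refine ⟨?_, ?_, ?_, ?_⟩
  · let f : Filter S :=
      { sets := ℱ
        univ_sets := h1
        sets_of_superset := fun {A B} hA hAB => h3 A hA B hAB
        inter_sets := fun {A B} hA hB => h4 A hA B hB }
    have hf : f.NeBot := ⟨fun h => h2 (Filter.empty_mem_iff_bot.mpr h : ∅ ∈ f)⟩
    exact ⟨Ultrafilter.of f, fun A hA => Ultrafilter.of_le f (show A ∈ f from hA)⟩
  · have h : {p : Ultrafilter S | ∀ A ∈ ℱ, A ∈ p} = ⋂ A ∈ ℱ, {p : Ultrafilter S | A ∈ p} := by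
      ext p
      simp
    rw [h]
    exact isClosed_biInter fun A _ => ultrafilter_isClosed_basic A
  · rintro p hp x rfl
    have hx : x ∈ ⋂₀ ℱ := fun A hA => Ultrafilter.mem_pure.mp (hp A hA)
    rw [hfree] at hx
    exact hx
  · intro p q hp hq A hA
    have key : ∀ᶠ m in ((p + q : Ultrafilter S) : Filter S), m ∈ A := by
      rw [Ultrafilter.eventually_add]
      refine Filter.mem_of_superset (hp _ (hidem A hA)) ?_
      rintro b ⟨C, hC, hb⟩
      exact Filter.mem_of_superset (hq C hC) hb
    exact key
end

section
/- Let S be a semigroup, and assume that ℱ is a free idempotent filter on S contained in an idempotent superfilter 𝒜 on S. Then there is a free (nonprincipal) idempotent ultrafilter e on S with ℱ ⊆ e ⊆ 𝒜. -/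
attribute [local instance] Ultrafilter.add Ultrafilter.addSemigroup

/-- If `ℱ` is a free idempotent filter on a semigroup `S` contained in an idempotent
superfilter `𝒜` on `S`, then there is a free (nonprincipal) idempotent ultrafilter `e`
with `ℱ ⊆ e ⊆ 𝒜`. -/
theorem exists_free_idempotent_ultrafilter_between {S : Type*} [AddSemigroup S]
    (ℱ : Set (Set S)) (hℱ : IsFilterFam ℱ) (hfree : ⋂₀ ℱ = ∅)
    (hidem : ∀ A ∈ ℱ, starSet A ℱ ∈ ℱ)
    (𝒜 : Set (Set S)) (h𝒜 : IsSuperfilter 𝒜)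
    (h𝒜idem : ∀ A : Set S, starSet A 𝒜 ∈ 𝒜 → A ∈ 𝒜)
    (hℱ𝒜 : ℱ ⊆ 𝒜) :
    ∃ e : Ultrafilter S, (∀ x : S, e ≠ pure x) ∧ e + e = e ∧
      (∀ A ∈ ℱ, A ∈ e) ∧ ∀ A ∈ e, A ∈ 𝒜 := by
  obtain ⟨hF1, hF0, hFup, hFint⟩ := hℱ
  obtain ⟨hA1, hAinf, hAup, hAun⟩ := h𝒜
  let G : Filter S :=
    { sets := {X | ∃ F ∈ ℱ, ∃ B, B ∉ 𝒜 ∧ F ⊆ X ∪ B}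
      univ_sets := ⟨Set.univ, hF1, ∅, fun h => hAinf _ h Set.finite_empty, by simp⟩
      sets_of_superset := by
        rintro X Y ⟨F, hF, B, hB, h⟩ hXY
        exact ⟨F, hF, B, hB, h.trans (Set.union_subset_union_left _ hXY)⟩
      inter_sets := by
        rintro X Y ⟨F, hF, B, hB, h⟩ ⟨F', hF', B', hB', h'⟩
        refine ⟨F ∩ F', hFint _ hF _ hF', B ∪ B', fun hh => (hAun _ _ hh).elim hB hB', ?_⟩
        rintro x ⟨hx, hx'⟩
        rcases h hx with h1 | h1 <;> rcases h' hx' with h2 | h2 <;> simp [h1, h2] }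
  have hG : ∀ X, X ∈ G ↔ ∃ F ∈ ℱ, ∃ B, B ∉ 𝒜 ∧ F ⊆ X ∪ B := fun X => Iff.rfl
  have hGne : G.NeBot := by
    refine ⟨fun h => ?_⟩
    have h0 : (∅ : Set S) ∈ G := by rw [h]; exact Filter.mem_bot
    obtain ⟨F, hF, B, hB, hs⟩ := (hG _).1 h0
    exact hB (hAup F (hℱ𝒜 hF) B (by simpa using hs))
  let T : Set (Ultrafilter S) := {p | (∀ A ∈ ℱ, A ∈ p) ∧ ∀ A ∈ p, A ∈ 𝒜}
  have hTne : T.Nonempty := by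
    refine ⟨Ultrafilter.of G, fun A hA => ?_, fun A hA => ?_⟩
    · exact Ultrafilter.of_le G ((hG _).2 ⟨A, hA, ∅, fun h => hAinf _ h Set.finite_empty, by simp⟩)
    · by_contra hn
      have h1 : Aᶜ ∈ Ultrafilter.of G :=
        Ultrafilter.of_le G ((hG _).2 ⟨Set.univ, hF1, A, hn, by simp⟩)
      exact (Ultrafilter.compl_mem_iff_notMem.1 h1) hA
  have hTc : IsCompact T := by
    have hT : T = (⋂ A ∈ ℱ, {p : Ultrafilter S | A ∈ p}) ∩
        ⋂ A ∈ 𝒜ᶜ, {p : Ultrafilter S | Aᶜ ∈ p} := by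
      ext p
      simp only [T, Set.mem_inter_iff, Set.mem_iInter, Set.mem_setOf_eq, Set.mem_compl_iff,
        Ultrafilter.compl_mem_iff_notMem]
      exact and_congr Iff.rfl (forall_congr' fun A => not_imp_not.symm)
    rw [hT]
    exact ((isClosed_biInter fun A _ => ultrafilter_isClosed_basic A).inter
      (isClosed_biInter fun A _ => ultrafilter_isClosed_basic Aᶜ)).isCompact
  have hadd : ∀ (p q : Ultrafilter S) (A : Set S), A ∈ p + q ↔ {b | {c | b + c ∈ A} ∈ q} ∈ p :=
    fun p q A => Ultrafilter.eventually_add p q (· ∈ A)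
  have hTa : ∀ᵉ (p ∈ T) (q ∈ T), p + q ∈ T := by
    rintro p ⟨hp, hp'⟩ q ⟨hq, hq'⟩
    refine ⟨fun A hA => ?_, fun A hA => ?_⟩
    · rw [hadd]
      refine Filter.mem_of_superset (hp _ (hidem A hA)) ?_
      rintro b ⟨C, hC, h⟩
      exact Filter.mem_of_superset (hq _ hC) h
    · rw [hadd] at hA
      refine h𝒜idem A (hAup _ (hp' _ hA) _ ?_)
      intro b hb
      exact ⟨_, hq' _ hb, fun c hc => hc⟩
  obtain ⟨e, ⟨he1, he2⟩, hee⟩ := exists_idempotent_in_compact_add_subsemigroup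
    Ultrafilter.continuous_add_left T hTne hTc hTa
  refine ⟨e, ?_, hee, he1, he2⟩
  rintro x rfl
  exact hAinf _ (he2 {x} (by simp)) (Set.finite_singleton x)
end

section
/- Let S be a semigroup and 𝒜 a superfilter on S. For every free idempotent chain A₁ ⊇ A₂ ⊇ ⋯ with each Aₙ ∈ 𝒜, the filter generated by the sets A₁, A₂, … is a free idempotent filter on S contained in 𝒜. -/
/-- A free idempotent chain: a descending sequence of infinite sets with empty
intersection such that each `Aₙ⋆({A₁,A₂,…})` contains some `A_m`. -/
def IsFreeIdemChain {S : Type*} [AddSemigroup S] (A : ℕ → Set S) : Prop :=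
  (∀ n, (A n).Infinite) ∧ (∀ n, A (n + 1) ⊆ A n) ∧ (⋂ n, A n) = ∅ ∧
    ∀ n, ∃ m, A m ⊆ starSet (A n) (Set.range A)

/-- For a superfilter `𝒜` on a semigroup `S` and a free idempotent chain `A₀ ⊇ A₁ ⊇ ⋯`
of members of `𝒜`, the filter generated by the sets `Aₙ` is a free idempotent filter
contained in `𝒜`. -/
theorem chain_generates_free_idem_filter {S : Type*} [AddSemigroup S]
    (𝒜 : Set (Set S)) (h𝒜 : IsSuperfilter 𝒜)
    (A : ℕ → Set S) (hchain : IsFreeIdemChain A) (hA𝒜 : ∀ n, A n ∈ 𝒜) :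
    IsFilterFam {B : Set S | ∃ n, A n ⊆ B} ∧
    ⋂₀ {B : Set S | ∃ n, A n ⊆ B} = ∅ ∧
    (∀ B ∈ {B : Set S | ∃ n, A n ⊆ B},
      starSet B {B : Set S | ∃ n, A n ⊆ B} ∈ {B : Set S | ∃ n, A n ⊆ B}) ∧
    {B : Set S | ∃ n, A n ⊆ B} ⊆ 𝒜 := by
  obtain ⟨hinf, hdesc, hempty, hidem⟩ := hchain
  have hanti : Antitone A := antitone_nat_of_succ_le hdesc
  refine ⟨⟨⟨0, Set.subset_univ _⟩, ?_, ?_, ?_⟩, ?_, ?_, ?_⟩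
  · rintro ⟨n, hn⟩
    exact (hinf n).nonempty.ne_empty (Set.subset_empty_iff.mp hn)
  · rintro B ⟨n, hn⟩ C hBC
    exact ⟨n, hn.trans hBC⟩
  · rintro B ⟨n, hn⟩ C ⟨m, hm⟩
    exact ⟨max n m, Set.subset_inter ((hanti (le_max_left n m)).trans hn)
      ((hanti (le_max_right n m)).trans hm)⟩
  · rw [← Set.subset_empty_iff, ← hempty]
    intro x hx
    exact Set.mem_iInter.mpr fun n => hx (A n) ⟨n, Set.Subset.rfl⟩
  · rintro B ⟨n, hn⟩
    obtain ⟨m, hm⟩ := hidem n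
    refine ⟨m, fun x hx => ?_⟩
    obtain ⟨C, ⟨k, rfl⟩, hC⟩ := hm hx
    exact ⟨A k, ⟨k, Set.Subset.rfl⟩, fun c hc => hn (hC c hc)⟩
  · rintro B ⟨n, hn⟩
    exact h𝒜.2.2.1 (A n) (hA𝒜 n) B hn
end

section
/- Let S be a countable semigroup, and let χ be a finite coloring of S and a finite coloring of [S]². Then there is a finite coloring η of [S]² such that, for every proper sequence b₁,b₂,… in S whose sum graph is η-monochromatic, the set FS(b₁,b₂,…) is χ-monochromatic and the sum graph of (bₙ) is χ-monochromatic. -/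
/-- For a countable semigroup `S` with a finite coloring `χ₁` of `S` and a finite coloring
`χ₂` of the 2-element subsets of `S`, there is a finite coloring `η` of the 2-element
subsets of `S` such that for every proper sequence `b` with `η`-monochromatic sum graph,
the set `FS(b)` is `χ₁`-monochromatic and the sum graph of `b` is `χ₂`-monochromatic. -/
theorem two_dim_to_one_dim {S : Type*} [AddSemigroup S] [Countable S]
    (k r : ℕ) (χ₁ : S → Fin k) (χ₂ : Sym2 S → Fin r) :
    ∃ (r' : ℕ) (η : Sym2 S → Fin r'),
      ∀ b : ℕ → S, IsProper b →
        (∃ c : Fin r', ∀ F H : Finset ℕ, F.Nonempty → H.Nonempty → FinsetLT F H →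
          η s(fsum b F, fsum b H) = c) →
        (∃ c₁ : Fin k, ∀ s ∈ FSset b, χ₁ s = c₁) ∧
        (∃ c₂ : Fin r, ∀ F H : Finset ℕ, F.Nonempty → H.Nonempty → FinsetLT F H →
          χ₂ s(fsum b F, fsum b H) = c₂) := by
  classical
  obtain ⟨e, he⟩ := exists_injective_nat S
  have key : ∃ m : Sym2 S → Fin k, ∀ x y, e x < e y → m s(x, y) = χ₁ x := by
    refine ⟨Sym2.lift ⟨fun x y => if e x ≤ e y then χ₁ x else χ₁ y, ?_⟩, ?_⟩
    · intro x y
      dsimp only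
      rcases lt_trichotomy (e x) (e y) with h | h | h
      · rw [if_pos h.le, if_neg (not_le.mpr h)]
      · rw [he h]
      · rw [if_neg (not_le.mpr h), if_pos h.le]
    · intro x y h
      simp [h.le]
  obtain ⟨m, hm⟩ := key
  refine ⟨r * k, fun p => finProdFinEquiv (χ₂ p, m p), ?_⟩
  rintro b hb ⟨c, hc⟩
  have hc' : ∀ F H : Finset ℕ, F.Nonempty → H.Nonempty → FinsetLT F H →
      χ₂ s(fsum b F, fsum b H) = (finProdFinEquiv.symm c).1 ∧
      m s(fsum b F, fsum b H) = (finProdFinEquiv.symm c).2 := by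
    intro F H hF hH hFH
    rw [← hc F H hF hH hFH, Equiv.symm_apply_apply]
    exact ⟨rfl, rfl⟩
  have hs : ∀ n, fsum b {n} = b n := by
    intro n
    simp [fsum]
  have hlt : ∀ i j, i < j → b i ≠ b j := by
    intro i j hij
    have := hb {i} {j} (by simp) (by simp) (by simpa [FinsetLT] using hij)
    rwa [hs, hs] at this
  have hinj : Function.Injective b := by
    intro i j hij
    rcases lt_trichotomy i j with h | h | h
    · exact absurd hij (hlt i j h)
    · exact h
    · exact absurd hij.symm (hlt j i h)
  refine ⟨⟨(finProdFinEquiv.symm c).2, ?_⟩, ⟨(finProdFinEquiv.symm c).1, ?_⟩⟩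
  · rintro s ⟨F, hF, rfl⟩
    have ht := (he.comp hinj).nat_tendsto_atTop
    obtain ⟨n, hn1, hn2⟩ := ((ht.eventually_gt_atTop (e (fsum b F))).and
      (Filter.eventually_gt_atTop (F.sup id))).exists
    have hFn : FinsetLT F {n} := by
      intro i hi j hj
      rw [Finset.mem_singleton] at hj
      subst hj
      exact lt_of_le_of_lt (Finset.le_sup (f := id) hi) hn2
    have h := (hc' F {n} hF (by simp) hFn).2
    rwa [hs, hm _ _ hn1] at h
  · intro F H hF hH hFH
    exact (hc' F H hF hH hFH).1
end

section
/- Let ℱ₁, ℱ₂, … be families of nonempty finite subsets of ℕ, and A ⊆ ℕ. Assume that every cofinite subset of A contains a member of each family ℱₙ. Then for each finite coloring of Fin and each finite coloring of [Fin]², there are nonempty finite subsets F₁ < F₂ < ⋯ of A such that: (1) each set Fₙ contains some member of the family ℱₙ; (2) all nonempty finite unions ⋃_{n∈G}Fₙ, for nonempty finite sets G ⊆ ℕ, have the same color; (3) all pairs {⋃_{n∈G}Fₙ, ⋃_{n∈H}Fₙ}, for nonempty finite sets G < H, have the same color. -/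
open Filter in
theorem mt_exists_ultrafilter (E : ℕ → Set (Finset ℕ)) (hE : ∀ n, (E n).Nonempty)
    (hmono : ∀ n, E (n + 1) ⊆ E n) (hun : ∀ n, ∀ x ∈ E n, ∀ y ∈ E n, x ∪ y ∈ E n) :
    ∃ U : Ultrafilter (Finset ℕ), (∀ n, E n ∈ U) ∧
      ∀ s ∈ U, {x | {y | x ∪ y ∈ s} ∈ U} ∈ U := by
  let : Semigroup (Finset ℕ) := { mul := (· ∪ ·), mul_assoc := Finset.union_assoc }
  let : Semigroup (Ultrafilter (Finset ℕ)) := Ultrafilter.semigroup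
  let S : Set (Ultrafilter (Finset ℕ)) := ⋂ n, { U | E n ∈ U }
  have h := exists_idempotent_in_compact_subsemigroup
    (Ultrafilter.continuous_mul_left (M := Finset ℕ)) S ?_ ?_ ?_
  · rcases h with ⟨U, hU, hid⟩
    refine ⟨U, fun n => Set.mem_iInter.mp hU n, fun s hs => ?_⟩
    have h2 : ∀ᶠ m in ↑(U * U), m ∈ s := by rw [hid]; exact hs
    exact (Ultrafilter.eventually_mul U U (fun m => m ∈ s)).1 h2
  · apply IsCompact.nonempty_iInter_of_sequence_nonempty_isCompact_isClosed
    · intro n U hU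
      exact mem_of_superset hU (hmono n)
    · intro n
      exact ⟨pure (hE n).some, mem_pure.mpr (hE n).some_mem⟩
    · exact (ultrafilter_isClosed_basic _).isCompact
    · intro n
      apply ultrafilter_isClosed_basic
  · exact IsClosed.isCompact (isClosed_iInter fun i => ultrafilter_isClosed_basic _)
  · intro U hU V hV
    refine Set.mem_iInter.mpr fun n => ?_
    refine (Ultrafilter.eventually_mul U V (fun m => m ∈ E n)).2 ?_
    filter_upwards [Set.mem_iInter.mp hU n] with x hx
    filter_upwards [Set.mem_iInter.mp hV n] with y hy
    exact hun n x hx y hy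

open Filter in
theorem mt_seq (U : Ultrafilter (Finset ℕ)) (hU : ∀ s ∈ U, {x | {y | x ∪ y ∈ s} ∈ U} ∈ U)
    (E : ℕ → Set (Finset ℕ)) (hE : ∀ n, E n ∈ U) (s₀ : Set (Finset ℕ)) (hs₀ : s₀ ∈ U)
    (D : Finset ℕ → Set (Finset ℕ)) (hD : ∀ x, D x ∈ U) :
    ∃ F : ℕ → Finset ℕ, (∀ n, F n ∈ E n) ∧
      (∀ G : Finset ℕ, G.Nonempty → G.biUnion F ∈ s₀) ∧
      (∀ G H : Finset ℕ, G.Nonempty → H.Nonempty → FinsetLT G H →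
        H.biUnion F ∈ D (G.biUnion F)) := by
  classical
  have key : ∀ (n : ℕ) (s : {s : Set (Finset ℕ) // s ∈ U}),
      ∃ x, x ∈ s.1 ∧ x ∈ E n ∧ {y | x ∪ y ∈ s.1} ∈ U := by
    intro n s
    obtain ⟨x, ⟨h1, h2⟩, h3⟩ := Ultrafilter.nonempty_of_mem
      (inter_mem (inter_mem s.2 (hE n)) (hU s.1 s.2))
    exact ⟨x, h1, h2, h3⟩
  choose el hel1 hel2 hel3 using key
  let T' : ℕ → {s : Set (Finset ℕ) // s ∈ U} × Finset (Finset ℕ) → Finset (Finset ℕ) :=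
    fun n p => insert (el n p.1) (p.2 ∪ p.2.image (fun X => el n p.1 ∪ X))
  have hT' : ∀ n p, ((p.1.1 ∩ {y | el n p.1 ∪ y ∈ p.1.1}) ∩ ⋂ X ∈ T' n p, D X) ∈ U := by
    intro n p
    exact inter_mem (inter_mem p.1.2 (hel3 n p.1))
      ((biInter_finset_mem _).2 fun X _ => hD X)
  let st : ℕ → {s : Set (Finset ℕ) // s ∈ U} × Finset (Finset ℕ) := fun n =>
    Nat.rec (⟨s₀, hs₀⟩, ∅) (fun n p => (⟨_, hT' n p⟩, T' n p)) n
  let F : ℕ → Finset ℕ := fun n => el n (st n).1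
  have hs1 : ∀ n, (st (n+1)).1.1 =
    (((st n).1.1 ∩ {y | F n ∪ y ∈ (st n).1.1}) ∩ ⋂ X ∈ (st (n+1)).2, D X) := fun n => rfl
  have hT1 : ∀ n, (st (n+1)).2 = insert (F n) ((st n).2 ∪ (st n).2.image (fun X => F n ∪ X)) :=
    fun n => rfl
  have hF1 : ∀ n, F n ∈ (st n).1.1 := fun n => hel1 n _
  have hsm : Antitone fun n => (st n).1.1 := by
    refine antitone_nat_of_succ_le fun n => ?_
    simp only [hs1 n]
    exact fun x hx => hx.1.1
  have hTm : Monotone fun n => (st n).2 := by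
    refine monotone_nat_of_le_succ fun n => ?_
    simp only [hT1 n]
    intro x hx
    simp only [Finset.mem_insert, Finset.mem_union]
    exact Or.inr (Or.inl hx)
  have cA : ∀ H : Finset ℕ, H.Nonempty → ∀ n, (∀ i ∈ H, n ≤ i) → H.biUnion F ∈ (st n).1.1 := by
    intro H
    induction H using Finset.induction_on_min with
    | empty => intro h; exact absurd h Finset.not_nonempty_empty
    | insert a s has ih =>
      intro _ n hn
      have hna : n ≤ a := hn a (Finset.mem_insert_self _ _)
      apply hsm hna
      rcases s.eq_empty_or_nonempty with rfl | hs
      · simpa using hF1 a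
      · have := ih hs (a+1) (fun i hi => has i hi)
        rw [hs1] at this
        rw [Finset.biUnion_insert]
        exact this.1.2
  have cB : ∀ G : Finset ℕ, G.Nonempty → ∀ n, (∀ i ∈ G, i < n) → G.biUnion F ∈ (st n).2 := by
    intro G
    induction G using Finset.induction_on_max with
    | empty => intro h; exact absurd h Finset.not_nonempty_empty
    | insert a s has ih =>
      intro _ n hn
      have hna : a + 1 ≤ n := hn a (Finset.mem_insert_self _ _)
      apply hTm hna
      simp only [hT1]
      rcases s.eq_empty_or_nonempty with rfl | hs
      · simp
      · have := ih hs a has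
        rw [Finset.biUnion_insert]
        simp only [Finset.mem_insert, Finset.mem_union, Finset.mem_image]
        exact Or.inr (Or.inr ⟨_, this, rfl⟩)
  refine ⟨F, fun n => hel2 n _, fun G hG => cA G hG 0 (fun i _ => Nat.zero_le i), ?_⟩
  intro G H hG hH hGH
  have h1 := cB G hG (G.max' hG + 1) (fun i hi => Nat.lt_succ_of_le (G.le_max' i hi))
  have h2 := cA H hH (G.max' hG + 1) (fun j hj => hGH _ (G.max'_mem hG) j hj)
  rw [hs1] at h2
  exact Set.mem_iInter₂.1 h2.2 _ h1

open Filter in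
theorem mt_color_s12 (U : Ultrafilter (Finset ℕ)) {k : ℕ} (χ : Finset ℕ → Fin k) :
    ∃ c, {x | χ x = c} ∈ U := by
  have h : (⋃ c ∈ (Set.univ : Set (Fin k)), {x | χ x = c}) ∈ U := by
    convert! (univ_mem : Set.univ ∈ (U : Filter (Finset ℕ)))
    ext x; simp
  obtain ⟨c, -, hc⟩ := (Ultrafilter.finite_biUnion_mem_iff Set.finite_univ).1 h
  exact ⟨c, hc⟩

/-- Let `ℱ₀, ℱ₁, …` be families of nonempty finite subsets of `ℕ` and `A ⊆ ℕ` such that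
every cofinite subset of `A` contains a member of each `ℱₙ`. Then for all finite colorings
of `Fin` and of the 2-element subsets of `Fin`, there are nonempty finite subsets
`F₀ < F₁ < ⋯` of `A`, each `Fₙ` containing a member of `ℱₙ`, such that all finite unions
`⋃_{n∈G} Fₙ` have the same color and all pairs `{⋃_{n∈G} Fₙ, ⋃_{n∈H} Fₙ}` with `G < H`
have the same color. -/
theorem milliken_taylor_families {ℱ : ℕ → Set (Finset ℕ)} {A : Set ℕ}
    (hne : ∀ n, ∀ G ∈ ℱ n, G.Nonempty)
    (hcof : ∀ B : Set ℕ, B ⊆ A → (A \ B).Finite → ∀ n, ∃ G ∈ ℱ n, ↑G ⊆ B)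
    (k r : ℕ) (χ₁ : Finset ℕ → Fin k) (χ₂ : Sym2 (Finset ℕ) → Fin r) :
    ∃ F : ℕ → Finset ℕ, (∀ n, (F n).Nonempty) ∧ (∀ n, ↑(F n) ⊆ A) ∧
      (∀ n, FinsetLT (F n) (F (n + 1))) ∧
      (∀ n, ∃ G ∈ ℱ n, G ⊆ F n) ∧
      (∃ c₁ : Fin k, ∀ G : Finset ℕ, G.Nonempty → χ₁ (G.biUnion F) = c₁) ∧
      (∃ c₂ : Fin r, ∀ G H : Finset ℕ, G.Nonempty → H.Nonempty → FinsetLT G H →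
        χ₂ s(G.biUnion F, H.biUnion F) = c₂) := by
  classical
  let E : ℕ → Set (Finset ℕ) := fun N =>
    {X | (∀ x ∈ X, x ∈ A ∧ N ≤ x) ∧ ∀ n ≤ N, ∃ G ∈ ℱ n, G ⊆ X}
  obtain ⟨U, hUE, hU⟩ := mt_exists_ultrafilter E
    (by
      intro N
      have := hcof (A ∩ {x | N ≤ x}) Set.inter_subset_left
        ((Set.finite_lt_nat N).subset (by
          rintro x ⟨hx, hx'⟩
          by_contra hc
          exact hx' ⟨hx, show N ≤ x from not_lt.1 hc⟩))
      choose G hG hGs using this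
      refine ⟨(Finset.range (N+1)).biUnion G, ?_, fun n hn => ⟨G n, hG n, ?_⟩⟩
      · intro x hx
        obtain ⟨i, _, hi⟩ := Finset.mem_biUnion.1 hx
        exact hGs i hi
      · exact Finset.subset_biUnion_of_mem G (Finset.mem_range.2 (by omega)))
    (by
      rintro N X ⟨h1, h2⟩
      exact ⟨fun x hx => ⟨(h1 x hx).1, by have := (h1 x hx).2; omega⟩,
        fun n hn => h2 n (by omega)⟩)
    (by
      rintro N X ⟨h1, h2⟩ Y ⟨h3, _⟩
      refine ⟨fun x hx => ?_, fun n hn => ?_⟩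
      · rcases Finset.mem_union.1 hx with h | h
        exacts [h1 x h, h3 x h]
      · obtain ⟨G, hG, hGX⟩ := h2 n hn
        exact ⟨G, hG, hGX.trans Finset.subset_union_left⟩)
  obtain ⟨c₁, hc₁⟩ := mt_color_s12 U χ₁
  have hc := fun X => mt_color_s12 U (fun Y => χ₂ s(X, Y))
  choose c hc using hc
  obtain ⟨c₂, hc₂⟩ := mt_color_s12 U c
  obtain ⟨F, hFE, hF1, hF2⟩ := mt_seq U hU E hUE ({x | χ₁ x = c₁} ∩ {x | c x = c₂})
    (Filter.inter_mem hc₁ hc₂) (fun X => {Y | χ₂ s(X, Y) = c X} ∩ {Y | FinsetLT X Y})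
    (by
      intro X
      refine Filter.inter_mem (hc X) (Filter.mem_of_superset (hUE (X.sup id + 1)) ?_)
      rintro Y ⟨hY, _⟩ i hi j hj
      have h1 : i ≤ X.sup id := Finset.le_sup (f := id) hi
      have := (hY j hj).2
      omega)
  refine ⟨F, fun n => ?_, fun n x hx => ((hFE n).1 x hx).1, fun n => ?_,
    fun n => (hFE n).2 n le_rfl, ⟨c₁, fun G hG => (hF1 G hG).1⟩, ⟨c₂, ?_⟩⟩
  · obtain ⟨G, hG, hGF⟩ := (hFE n).2 n le_rfl
    exact (hne n G hG).mono hGF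
  · have := (hF2 {n} {n+1} (by simp) (by simp) (by intro i hi j hj; simp at hi hj; omega)).2
    simpa using this
  · intro G H hG hH hGH
    exact (hF2 G H hG hH hGH).1.trans (hF1 G hG).2
end

section
/- A topological space X is Menger if and only if Alice does not have a winning strategy in the game G1(Asc(X), Λ(X)). -/
/-- `𝒰` is an open cover of `X`. -/
def IsOpenCover {X : Type*} [TopologicalSpace X] (𝒰 : Set (Set X)) : Prop :=
  (∀ U ∈ 𝒰, IsOpen U) ∧ ⋃₀ 𝒰 = Set.univ

/-- `𝒰` has no finite subcover. -/
def NoFiniteSubcover {X : Type*} (𝒰 : Set (Set X)) : Prop :=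
  ¬∃ 𝒢 ⊆ 𝒰, 𝒢.Finite ∧ ⋃₀ 𝒢 = Set.univ

/-- `Asc(X)`: the open covers of `X` containing an ascending cover
`V₀ ⊊ V₁ ⊊ ⋯` of `X`. -/
def AscCovers (X : Type*) [TopologicalSpace X] : Set (Set (Set X)) :=
  {𝒰 | IsOpenCover 𝒰 ∧ ∃ V : ℕ → Set X,
    (∀ n, V n ⊂ V (n + 1)) ∧ (∀ n, V n ∈ 𝒰) ∧ (⋃ n, V n) = Set.univ}

/-- `Λ(X)`: the countable point-infinite open covers of `X`. -/
def LambdaCovers (X : Type*) [TopologicalSpace X] : Set (Set (Set X)) :=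
  {𝒰 | 𝒰.Countable ∧ IsOpenCover 𝒰 ∧ ∀ x : X, {U ∈ 𝒰 | x ∈ U}.Infinite}

/-- `X` is a Menger space: for each sequence of countable open covers `𝒰ₙ` there are
finite `ℱₙ ⊆ 𝒰ₙ` such that the sets `⋃ℱₙ` form a cover of `X`. -/
def MengerSpace (X : Type*) [TopologicalSpace X] : Prop :=
  ∀ 𝒰 : ℕ → Set (Set X), (∀ n, (𝒰 n).Countable ∧ IsOpenCover (𝒰 n)) →
    ∃ ℱ : ℕ → Set (Set X), (∀ n, (ℱ n).Finite ∧ ℱ n ⊆ 𝒰 n) ∧ (⋃ n, ⋃₀ ℱ n) = Set.univ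

/-- A winning strategy for Alice in the game `G1(𝒜, ℬ)`: `σ` assigns to each finite
sequence of Bob's previous moves a next move in `𝒜`, and for every play following `σ`
the set of Bob's choices is not in `ℬ` (so Alice wins every play). -/
def IsWinningAliceStrategy {α : Type*} (𝒜 ℬ : Set (Set α)) (σ : List α → Set α) : Prop :=
  (∀ l : List α, σ l ∈ 𝒜) ∧
    ∀ b : ℕ → α, (∀ n, b n ∈ σ (List.ofFn fun i : Fin n => b i)) → Set.range b ∉ ℬ

theorem asc_of_noFin {X : Type*} [TopologicalSpace X] (𝒰 : Set (Set X)) (hc : 𝒰.Countable)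
    (ho : IsOpenCover 𝒰) (hf : ∀ G ⊆ 𝒰, G.Finite → ⋃₀ G ≠ Set.univ) :
    ∃ V : ℕ → Set X, (∀ n, V n ⊂ V (n + 1)) ∧ (⋃ n, V n) = Set.univ ∧ (∀ n, IsOpen (V n)) ∧
      ∀ n, ∃ G ⊆ 𝒰, G.Finite ∧ V n = ⋃₀ G := by
  have hne : 𝒰.Nonempty := by
    by_contra h
    rw [Set.not_nonempty_iff_eq_empty] at h
    exact hf 𝒰 subset_rfl (by rw [h]; exact Set.finite_empty) ho.2
  obtain ⟨u, hu⟩ := hc.exists_eq_range hne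
  let A : ℕ → Set X := fun m => ⋃₀ (u '' Set.Iio m)
  have hsub : ∀ m, u '' Set.Iio m ⊆ 𝒰 := by
    rintro m _ ⟨i, _, rfl⟩
    rw [hu]; exact ⟨i, rfl⟩
  have hfin : ∀ m, (u '' Set.Iio m).Finite := fun m => (Set.finite_Iio m).image _
  have hmono : Monotone A := fun a b hab =>
    Set.sUnion_subset_sUnion (Set.image_mono (Set.Iio_subset_Iio hab))
  have hcov : ∀ x, ∃ m, x ∈ A m := by
    intro x
    have : x ∈ ⋃₀ 𝒰 := by rw [ho.2]; trivial
    obtain ⟨U, hU, hx⟩ := this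
    rw [hu] at hU
    obtain ⟨i, rfl⟩ := hU
    exact ⟨i + 1, u i, ⟨i, by simp, rfl⟩, hx⟩
  have hstep : ∀ m, ∃ m', m < m' ∧ A m ⊂ A m' := by
    intro m
    obtain ⟨x, hx⟩ := (Set.ne_univ_iff_exists_notMem _).1 (hf _ (hsub m) (hfin m))
    obtain ⟨k, hk⟩ := hcov x
    have hmk : m < k := by
      by_contra h
      exact hx (hmono (not_lt.1 h) hk)
    exact ⟨k, hmk, hmono hmk.le, fun h => hx (h hk)⟩
  choose g hg1 hg2 using hstep
  let e : ℕ → ℕ := fun n => Nat.rec 0 (fun _ r => g r) n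
  have he : ∀ n, e (n + 1) = g (e n) := fun n => rfl
  have hes : StrictMono e := strictMono_nat_of_lt_succ fun n => by rw [he]; exact hg1 _
  refine ⟨fun n => A (e n), fun n => hg2 (e n), ?_, ?_, ?_⟩
  · rw [Set.eq_univ_iff_forall]
    intro x
    obtain ⟨m, hm⟩ := hcov x
    exact Set.mem_iUnion.2 ⟨m, hmono (hes.le_apply) hm⟩
  · intro n
    exact isOpen_sUnion fun t ht => ho.1 t (hsub _ ht)
  · intro n
    exact ⟨_, hsub _, hfin _, rfl⟩

/-- reversed restriction of `f` to the first `n` values -/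
def revPre (f : ℕ → ℕ) : ℕ → List ℕ
  | 0 => []
  | n + 1 => f n :: revPre f n

/-- `x` is not covered along the node -/
def BadAt {X : Type*} (U : List ℕ → Set X) (x : X) : List ℕ → Prop
  | [] => True
  | k :: s => x ∉ U (k :: s) ∧ BadAt U x s

theorem badAt_revPre {X : Type*} (U : List ℕ → Set X) (x : X) (f : ℕ → ℕ)
    (h : ∀ n, x ∉ U (revPre f (n + 1))) (n : ℕ) : BadAt U x (revPre f n) := by
  induction n with
  | zero => trivial
  | succ n ih => exact ⟨h n, ih⟩

theorem length_revPre (f : ℕ → ℕ) (n : ℕ) : (revPre f n).length = n := by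
  induction n with
  | zero => rfl
  | succ n ih => simp [revPre, ih]

theorem revPre_add (f : ℕ → ℕ) (M n : ℕ) :
    revPre f (n + M) = revPre (fun i => f (i + M)) n ++ revPre f M := by
  induction n with
  | zero => simp [revPre]
  | succ n ih =>
    rw [show n + 1 + M = (n + M) + 1 by omega]
    simp [revPre, ih]

theorem tree_local {X : Type*} [TopologicalSpace X] (U : List ℕ → Set X)
    (ho : ∀ k s, IsOpen (U (k :: s))) (hm : ∀ s, Monotone fun k => U (k :: s))
    (hc : ∀ s x, ∃ k, x ∈ U (k :: s)) (x : X) (n : ℕ) :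
    ∃ F : Finset (List ℕ), ∃ O : Set X, IsOpen O ∧ x ∈ O ∧
      ∀ y ∈ O, ∀ s : List ℕ, s.length = n → BadAt U y s → s ∈ F := by
  classical
  induction n with
  | zero =>
    refine ⟨{[]}, Set.univ, isOpen_univ, trivial, ?_⟩
    intro y _ s hs _
    simpa using hs
  | succ n ih =>
    obtain ⟨F, O, hO, hx, hF⟩ := ih
    have hc' : ∀ s, ∃ k, x ∈ U (k :: s) := fun s => hc s x
    choose g hg using hc'
    refine ⟨F.biUnion fun s => (Finset.range (g s)).image fun k => k :: s,
      O ∩ ⋂ s ∈ F, U (g s :: s), hO.inter (isOpen_biInter_finset fun s _ => ho _ _),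
      ⟨hx, Set.mem_iInter₂.2 fun s _ => hg s⟩, ?_⟩
    rintro y ⟨hy1, hy2⟩ s hs hB
    cases s with
    | nil => simp at hs
    | cons k s =>
      have hsF : s ∈ F := hF y hy1 s (by simpa using hs) hB.2
      have hyU := Set.mem_iInter₂.1 hy2 s hsF
      have hk : k < g s := by
        by_contra h
        exact hB.1 (hm s (not_lt.1 h) hyU)
      rw [Finset.mem_biUnion]
      exact ⟨s, hsF, Finset.mem_image.2 ⟨k, Finset.mem_range.2 hk, rfl⟩⟩

theorem tree_menger {X : Type*} [TopologicalSpace X] (hM : MengerSpace X) (U : List ℕ → Set X)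
    (ho : ∀ k s, IsOpen (U (k :: s))) (hm : ∀ s, Monotone fun k => U (k :: s))
    (hc : ∀ s x, ∃ k, x ∈ U (k :: s)) :
    ∃ h : List ℕ → ℕ, ∀ f : ℕ → ℕ, (∀ n, h (revPre f n) ≤ f n) →
      ∀ x, ∃ n, x ∈ U (revPre f (n + 1)) := by
  classical
  let D : ℕ → Finset (List ℕ) → Set X := fun n F =>
    interior {y | ∀ s : List ℕ, s.length = n + 1 → BadAt U y s → s ∈ F}
  obtain ⟨ℱ, hℱ, hcov⟩ := hM (fun n => Set.range (D n)) (by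
    intro n
    refine ⟨Set.countable_range _, ?_, ?_⟩
    · rintro _ ⟨F, rfl⟩
      exact isOpen_interior
    · rw [Set.eq_univ_iff_forall]
      intro x
      obtain ⟨F, O, hO, hx, hF⟩ := tree_local U ho hm hc x (n + 1)
      exact ⟨_, ⟨F, rfl⟩, interior_maximal (fun y hy => hF y hy) hO hx⟩)
  have hG : ∀ n, ∃ G : Finset (List ℕ), ∀ x ∈ ⋃₀ ℱ n,
      ∀ s : List ℕ, s.length = n + 1 → BadAt U x s → s ∈ G := by
    intro n
    have hsub : ∀ A : Set X, ∃ F, A ∈ ℱ n → A = D n F := by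
      intro A
      by_cases hA : A ∈ ℱ n
      · obtain ⟨F, hF⟩ := (hℱ n).2 hA
        exact ⟨F, fun _ => hF.symm⟩
      · exact ⟨∅, fun h => absurd h hA⟩
    choose φ hφ using hsub
    refine ⟨(hℱ n).1.toFinset.biUnion φ, ?_⟩
    rintro x ⟨A, hA, hx⟩ s hs hB
    rw [hφ A hA] at hx
    exact Finset.mem_biUnion.2 ⟨A, (hℱ n).1.mem_toFinset.2 hA, interior_subset hx s hs hB⟩
  choose G hG using hG
  refine ⟨fun s => (G s.length).sup fun r => r.headI + 1, ?_⟩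
  intro f hf x
  by_contra hcon
  push Not at hcon
  have hx : x ∈ ⋃ n, ⋃₀ ℱ n := by rw [hcov]; trivial
  obtain ⟨n, hn⟩ := Set.mem_iUnion.1 hx
  have h1 := hG n x hn _ (length_revPre f (n + 1)) (badAt_revPre U x f hcon (n + 1))
  have h2 := hf n
  beta_reduce at h2
  rw [length_revPre] at h2
  have h3 := (Finset.le_sup (f := fun r : List ℕ => r.headI + 1) h1).trans h2
  simp [revPre] at h3

/-- history of the game along a node -/
def histOf {α : Type*} (W : List α → ℕ → α) : List ℕ → List α
  | [] => []
  | k :: s => histOf W s ++ [W (histOf W s) k]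

/-- nodes of the play determined by `h` -/
def playNode (h : List ℕ → ℕ) : ℕ → List ℕ
  | 0 => []
  | n + 1 => h (playNode h n) :: playNode h n

theorem revPre_playNode (h : List ℕ → ℕ) (n : ℕ) :
    revPre (fun i => h (playNode h i)) n = playNode h n := by
  induction n with
  | zero => rfl
  | succ n ih => simp [revPre, playNode, ih]

/-- the set chosen at a node -/
def nodeSet {X : Type*} (W : List (Set X) → ℕ → Set X) : List ℕ → Set X
  | [] => ∅
  | k :: s => W (histOf W s) k

theorem menger_play {X : Type*} [TopologicalSpace X] (hM : MengerSpace X)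
    (W : List (Set X) → ℕ → Set X) (ho : ∀ l k, IsOpen (W l k)) (hm : ∀ l, Monotone (W l))
    (hc : ∀ l x, ∃ k, x ∈ W l k) :
    ∃ f b : ℕ → _, (∀ n, b n = W (List.ofFn fun i : Fin n => b i) (f n)) ∧
      ∀ x, ∀ M, ∃ n ≥ M, x ∈ b n := by
  have key := fun t : List ℕ => tree_menger hM (fun s => nodeSet W (s ++ t))
    (fun k s => ho _ _) (fun s => hm _) (fun s x => hc _ x)
  choose h hh using key
  let H : List ℕ → ℕ := fun r => ∑ i ∈ Finset.range (r.length + 1), h (r.drop i) (r.take i)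
  have hH : ∀ s t, h t s ≤ H (s ++ t) := by
    intro s t
    have := Finset.single_le_sum (f := fun i => h ((s ++ t).drop i) ((s ++ t).take i))
      (s := Finset.range ((s ++ t).length + 1)) (fun _ _ => Nat.zero_le _)
      (Finset.mem_range.2 (show s.length < (s ++ t).length + 1 by rw [List.length_append]; omega))
    simpa [H] using this
  let f : ℕ → ℕ := fun i => H (playNode H i)
  have hf : ∀ n, f n = H (revPre f n) := by
    intro n
    rw [revPre_playNode]
  let b : ℕ → Set X := fun n => nodeSet W (revPre f (n + 1))
  have hhist : ∀ n, histOf W (revPre f n) = List.ofFn fun i : Fin n => b i := by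
    intro n
    induction n with
    | zero => simp [revPre, histOf]
    | succ n ih =>
      rw [List.ofFn_succ']
      simp only [revPre, histOf, List.concat_eq_append]
      congr 1
  refine ⟨f, b, ?_, ?_⟩
  · intro n
    rw [← hhist]
    rfl
  · intro x M
    obtain ⟨n, hn⟩ := hh (revPre f M) (fun i => f (i + M)) (by
      intro n
      change _ ≤ f (n + M)
      rw [hf, revPre_add]
      exact hH _ _) x
    refine ⟨n + M, by omega, ?_⟩
    change x ∈ nodeSet W (revPre f (n + M + 1))
    rw [show n + M + 1 = n + 1 + M by omega, revPre_add]
    exact hn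

theorem asc_avoid {X : Type*} [TopologicalSpace X] {𝒰 : Set (Set X)} (h : 𝒰 ∈ AscCovers X)
    (l : List (Set X)) : ∃ W : ℕ → Set X, (∀ k, IsOpen (W k)) ∧ Monotone W ∧
      (∀ x, ∃ k, x ∈ W k) ∧ (∀ k, W k ∈ 𝒰) ∧ ∀ k, W k ∉ l := by
  classical
  obtain ⟨⟨ho, -⟩, V, hV, hmem, hcov⟩ := h
  have hs : StrictMono V := strictMono_nat_of_lt_succ hV
  have hfin : (V ⁻¹' {A | A ∈ l}).Finite :=
    Set.Finite.preimage hs.injective.injOn l.finite_toSet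
  obtain ⟨N, hN⟩ := hfin.bddAbove
  refine ⟨fun k => V (k + N + 1), fun k => ho _ (hmem _), ?_, ?_, fun k => hmem _, ?_⟩
  · intro a b hab
    exact hs.monotone (by omega)
  · intro x
    have hx : x ∈ ⋃ n, V n := by rw [hcov]; trivial
    obtain ⟨n, hn⟩ := Set.mem_iUnion.1 hx
    exact ⟨n, hs.monotone (by omega) hn⟩
  · intro k hk
    have := hN hk
    omega

/-- A topological space `X` is Menger if and only if Alice does not have a winning
strategy in the game `G1(Asc(X), Λ(X))`. -/
theorem menger_iff_no_winning_strategy (X : Type*) [TopologicalSpace X] :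
    MengerSpace X ↔
      ¬∃ σ : List (Set X) → Set (Set X),
        IsWinningAliceStrategy (AscCovers X) (LambdaCovers X) σ := by
  constructor
  · rintro hM ⟨σ, hσ, hwin⟩
    have key := fun l : List (Set X) => asc_avoid (hσ l) l
    choose W ho hm hc hmem hav using key
    obtain ⟨f, b, hb, hx⟩ := menger_play hM W ho hm hc
    have hinj : Function.Injective b := by
      have : ∀ i j, i < j → b i ≠ b j := by
        intro i j hij he
        have h1 := hav (List.ofFn fun i : Fin j => b i) (f j)
        rw [← hb j, ← he] at h1
        exact h1 (List.mem_ofFn.2 ⟨⟨i, hij⟩, rfl⟩)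
      intro i j he
      rcases lt_trichotomy i j with h | h | h
      · exact absurd he (this _ _ h)
      · exact h
      · exact absurd he.symm (this _ _ h)
    refine hwin b (fun n => by
      have h1 := hmem (List.ofFn fun i : Fin n => b i) (f n)
      rwa [← hb n] at h1) ⟨Set.countable_range _, ⟨?_, ?_⟩, ?_⟩
    · rintro _ ⟨n, rfl⟩
      rw [hb n]; exact ho _ _
    · rw [Set.eq_univ_iff_forall]
      intro x
      obtain ⟨n, -, hn⟩ := hx x 0
      exact ⟨b n, ⟨n, rfl⟩, hn⟩
    · intro x
      have h1 : {n | x ∈ b n}.Infinite := by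
        rw [Set.infinite_iff_exists_gt]
        intro M
        obtain ⟨n, hn, hxn⟩ := hx x (M + 1)
        exact ⟨n, hxn, by omega⟩
      refine (h1.image hinj.injOn).mono ?_
      rintro _ ⟨n, hn, rfl⟩
      exact ⟨⟨n, rfl⟩, hn⟩
  · intro hno 𝒰 h𝒰
    by_contra hcon
    apply hno
    have hf : ∀ n, ∀ G ⊆ 𝒰 n, G.Finite → ⋃₀ G ≠ Set.univ := by
      intro n G hG hfin he
      classical
      refine hcon ⟨fun m => if m = n then G else ∅, ?_, ?_⟩
      · intro m
        by_cases hmn : m = n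
        · subst hmn; simp [hG, hfin]
        · simp [hmn]
      · rw [Set.eq_univ_iff_forall]
        intro x
        refine Set.mem_iUnion.2 ⟨n, ?_⟩
        simp only [if_true, he]
        trivial
    have key := fun n => asc_of_noFin (𝒰 n) (h𝒰 n).1 (h𝒰 n).2 (hf n)
    choose V hV hcov ho hG using key
    refine ⟨fun l => Set.range (V l.length), ?_, ?_⟩
    · intro l
      refine ⟨⟨?_, ?_⟩, V l.length, hV _, fun n => ⟨n, rfl⟩, hcov _⟩
      · rintro _ ⟨n, rfl⟩
        exact ho _ _
      · rw [Set.sUnion_range]; exact hcov _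
    · intro b hb hL
      simp only [List.length_ofFn, Set.mem_range] at hb
      choose k hk using hb
      choose G hG1 hG2 hG3 using hG
      refine hcon ⟨fun n => G n (k n), fun n => ⟨hG2 _ _, hG1 _ _⟩, ?_⟩
      have := hL.2.1.2
      rw [Set.sUnion_range] at this
      rw [← this]
      refine Set.iUnion_congr fun n => ?_
      rw [← hG3, hk]
end

section
/- Let (X,τ) be a topological space and ℬ a regular family of open covers of X. The following assertions are equivalent: (1) Ufin(O(X),ℬ); (2) S1(Asc(X),ℬ); (3) Alice does not have a winning strategy in the game G1(Asc(X),ℬ); (4) Alice does not have a winning strategy in the game associated to Ufin(O(X),ℬ), i.e., the game in which in inning n Alice plays a countable open cover 𝒰ₙ of X with no finite subcover, Bob selects a finite set ℱₙ ⊆ 𝒰ₙ, and Bob wins if {⋃ℱₙ : n ∈ ℕ} ∈ ℬ. -/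
/-- `Ufin(O(X), ℬ)`: for each sequence of countable open covers of `X` with no finite
subcover there are finite `ℱₙ ⊆ 𝒰ₙ` such that `{⋃ℱₙ : n ∈ ℕ} ∈ ℬ`. -/
def UfinProp {X : Type*} [TopologicalSpace X] (ℬ : Set (Set (Set X))) : Prop :=
  ∀ 𝒰 : ℕ → Set (Set X),
    (∀ n, (𝒰 n).Countable ∧ IsOpenCover (𝒰 n) ∧ NoFiniteSubcover (𝒰 n)) →
    ∃ ℱ : ℕ → Set (Set X), (∀ n, (ℱ n).Finite ∧ ℱ n ⊆ 𝒰 n) ∧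
      Set.range (fun n => ⋃₀ ℱ n) ∈ ℬ

/-- A regular family of open covers of `X`: it splits over unions, and is closed under
images of finite-to-one maps `f : 𝒰 → τ ∖ {X}` satisfying `U ⊆ f U`. -/
def IsRegularFamily (X : Type*) [TopologicalSpace X] (ℬ : Set (Set (Set X))) : Prop :=
  (∀ 𝒰 ∈ ℬ, IsOpenCover 𝒰) ∧
  (∀ 𝒰 𝒱 : Set (Set X), 𝒰 ∪ 𝒱 ∈ ℬ → 𝒰 ∈ ℬ ∨ 𝒱 ∈ ℬ) ∧
  (∀ 𝒰 ∈ ℬ, ∀ f : Set X → Set X,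
    (∀ U ∈ 𝒰, IsOpen (f U) ∧ f U ≠ Set.univ ∧ U ⊆ f U) →
    (∀ V : Set X, {U ∈ 𝒰 | f U = V}.Finite) →
    f '' 𝒰 ∈ ℬ)

/-- `S1(𝒜, ℬ)`: from each sequence of members of `𝒜` one can select one element per member
so that the selected elements form a set in `ℬ`. -/
def S1Prop {α : Type*} (𝒜 ℬ : Set (Set α)) : Prop :=
  ∀ A : ℕ → Set α, (∀ n, A n ∈ 𝒜) →
    ∃ b : ℕ → α, (∀ n, b n ∈ A n) ∧ Set.range b ∈ ℬ

/-- A winning strategy for Alice in the game associated to `Ufin(O(X), ℬ)`: in each inning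
Alice plays a countable open cover with no finite subcover, Bob picks a finite subset of it,
and Bob wins if the unions of his choices form a family in `ℬ`. -/
def IsWinningAliceUfin {X : Type*} [TopologicalSpace X] (ℬ : Set (Set (Set X)))
    (σ : List (Set (Set X)) → Set (Set X)) : Prop :=
  (∀ l : List (Set (Set X)),
    (σ l).Countable ∧ IsOpenCover (σ l) ∧ NoFiniteSubcover (σ l)) ∧
  ∀ G : ℕ → Set (Set X),
    (∀ n, (G n).Finite ∧ G n ⊆ σ (List.ofFn fun i : Fin n => G i)) →
    Set.range (fun n => ⋃₀ G n) ∉ ℬ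

/-- Strictly ascending sequence of open sets covering the space. -/
def AscSeq {X : Type*} [TopologicalSpace X] (V : ℕ → Set X) : Prop :=
  (∀ n, IsOpen (V n)) ∧ (∀ n, V n ⊂ V (n + 1)) ∧ (⋃ n, V n) = Set.univ

theorem AscSeq.strictMono {X : Type*} [TopologicalSpace X] {V : ℕ → Set X} (h : AscSeq V) :
    StrictMono V := strictMono_nat_of_lt_succ h.2.1

theorem AscSeq.ne_univ {X : Type*} [TopologicalSpace X] {V : ℕ → Set X} (h : AscSeq V) (n : ℕ) :
    V n ≠ Set.univ := by
  intro hn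
  have := h.2.1 n
  rw [hn] at this
  exact this.2 (Set.subset_univ _)

theorem AscSeq.nonempty {X : Type*} [TopologicalSpace X] {V : ℕ → Set X} (h : AscSeq V) :
    Nonempty X := by
  obtain ⟨x, -, -⟩ := Set.exists_of_ssubset (h.2.1 0)
  exact ⟨x⟩

theorem AscSeq.exists_mem {X : Type*} [TopologicalSpace X] {V : ℕ → Set X} (h : AscSeq V) (x : X) :
    ∃ n, x ∈ V n := by
  have : x ∈ ⋃ n, V n := by rw [h.2.2]; trivial
  simpa using this

theorem regular_infinite {X : Type*} [TopologicalSpace X] [Nonempty X]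
    {ℬ : Set (Set (Set X))} (hreg : IsRegularFamily X ℬ) (𝒰 : Set (Set X))
    (hU : 𝒰 ∈ ℬ) (hne : Set.univ ∉ 𝒰) : 𝒰.Infinite := by
  intro hfin
  revert hU hne
  induction 𝒰, hfin using Set.Finite.induction_on with
  | empty =>
    intro h _
    have := (hreg.1 _ h).2
    simp at this
    exact Set.empty_ne_univ this
  | insert ha hs ih =>
    intro h hne
    rw [Set.insert_eq] at h
    rcases hreg.2.1 _ _ h with h | h
    · have := (hreg.1 _ h).2
      simp at this
      apply hne
      simp [this]
    · exact ih h (fun h' => hne (Set.mem_insert_of_mem _ h'))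

theorem lemmaA {X : Type*} [TopologicalSpace X]
    {ℬ : Set (Set (Set X))} (hreg : IsRegularFamily X ℬ) (hU : UfinProp ℬ)
    (W : ℕ → ℕ → Set X) (hW : ∀ i, AscSeq (W i)) :
    ∃ (D : ℕ → Set X) (F : ℕ → ℕ), Function.Injective D ∧ Set.range D ∈ ℬ ∧
      ∀ j, ∀ i ≤ j, D j ⊆ W i (F j) := by
  have := (hW 0).nonempty
  set I : ℕ → ℕ → Set X := fun n k => ⋂ i ∈ Finset.range (n+1), W i k with hI
  have hmono : ∀ n, Monotone (I n) := by
    intro n a b hab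
    exact Set.iInter₂_mono fun i _ => (hW i).strictMono.monotone hab
  have hsub : ∀ n k, ∀ i ≤ n, I n k ⊆ W i k := by
    intro n k i hi
    exact Set.biInter_subset_of_mem (by simp; omega)
  have hfinsub : ∀ n, ∀ 𝒢 ⊆ Set.range (I n), 𝒢.Finite → ∃ k, ⋃₀ 𝒢 ⊆ I n k := by
    intro n 𝒢 h𝒢 hfin
    induction 𝒢, hfin using Set.Finite.induction_on with
    | empty => exact ⟨0, by simp⟩
    | insert ha hs ih =>
      obtain ⟨k, hk⟩ := ih (fun x hx => h𝒢 (Set.mem_insert_of_mem _ hx))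
      obtain ⟨l, hl⟩ := h𝒢 (Set.mem_insert _ _)
      refine ⟨max k l, ?_⟩
      rw [Set.sUnion_insert, ← hl]
      exact Set.union_subset (hmono n (le_max_right _ _))
        (hk.trans (hmono n (le_max_left _ _)))
  have hneuniv : ∀ n k, I n k ≠ Set.univ := by
    intro n k h
    apply (hW 0).ne_univ k
    exact Set.eq_univ_of_univ_subset (h ▸ hsub n k 0 (Nat.zero_le _))
  obtain ⟨ℱ, hF, hFB⟩ := hU (fun n => Set.range (I n)) (by
    intro n
    refine ⟨Set.countable_range _, ⟨?_, ?_⟩, ?_⟩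
    · rintro _ ⟨k, rfl⟩
      exact isOpen_biInter_finset fun i _ => (hW i).1 k
    · rw [Set.eq_univ_iff_forall]
      intro x
      choose m hm using fun i => (hW i).exists_mem x
      refine ⟨I n ((Finset.range (n+1)).sup m), ⟨_, rfl⟩, ?_⟩
      simp only [hI, Set.mem_iInter]
      intro i hi
      exact (hW i).strictMono.monotone (Finset.le_sup hi) (hm i)
    · rintro ⟨𝒢, h1, h2, h3⟩
      obtain ⟨k, hk⟩ := hfinsub n 𝒢 h1 h2
      exact hneuniv n k (Set.eq_univ_of_univ_subset (h3 ▸ hk)))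
  choose f hf using fun n => hfinsub n (ℱ n) (hF n).2 (hF n).1
  set E : ℕ → Set X := fun n => ⋃₀ ℱ n with hE
  have hinf : (Set.range E).Infinite := by
    apply regular_infinite hreg _ hFB
    rintro ⟨n, hn⟩
    exact hneuniv n (f n) (Set.eq_univ_of_univ_subset (hn ▸ hf n))
  set N : Set ℕ := {n | ∀ m < n, E m ≠ E n} with hN
  have himg : E '' N = Set.range E := by
    apply Set.Subset.antisymm (Set.image_subset_range _ _)
    rintro _ ⟨n, rfl⟩
    classical
    have hex : ∃ m, E m = E n := ⟨n, rfl⟩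
    refine ⟨Nat.find hex, ?_, Nat.find_spec hex⟩
    intro m hm h
    exact Nat.find_min hex hm (h.trans (Nat.find_spec hex))
  have hNinf : N.Infinite := by
    intro h
    apply hinf
    rw [← himg]
    exact h.image _
  classical
  set nn : ℕ → ℕ := Nat.nth (· ∈ N) with hnn
  have hmem : ∀ j, nn j ∈ N := fun j => Nat.nth_mem_of_infinite hNinf j
  have hsm : StrictMono nn := Nat.nth_strictMono hNinf
  have hrange : Set.range nn = N := Nat.range_nth_of_infinite hNinf
  refine ⟨fun j => E (nn j), fun j => f (nn j), ?_, ?_, ?_⟩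
  · intro a b hab
    rcases lt_trichotomy a b with h | h | h
    · exact absurd hab (hmem b _ (hsm h))
    · exact h
    · exact absurd hab.symm (hmem a _ (hsm h))
  · have : Set.range (fun j => E (nn j)) = Set.range E := by
      rw [← himg, ← hrange, ← Set.range_comp]; rfl
    rw [this]; exact hFB
  · intro j i hij
    exact (hf _).trans (hsub _ _ _ (hij.trans (hsm.id_le j)))

theorem lemmaB {X : Type*} [TopologicalSpace X]
    {ℬ : Set (Set (Set X))} (hreg : IsRegularFamily X ℬ) (hU : UfinProp ℬ)
    (W : ℕ → ℕ → Set X) (hW : ∀ i, AscSeq (W i)) (nx : ℕ → ℕ → ℕ) :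
    ∃ p g : ℕ → ℕ, p 0 = 0 ∧ (∀ t, p (t+1) = nx (p t) (g t)) ∧
      Set.range (fun t => W (p t) (g t)) ∈ ℬ := by
  obtain ⟨D, F, hDi, hDB, hDF⟩ := lemmaA hreg hU W hW
  have hk : ∀ i b : ℕ, ∃ k, (∀ m < b, F m ≤ k) ∧ ∀ q ≤ b, ∀ k' ≤ b, W i k ≠ W q k' := by
    intro i b
    have hfin : (((fun x : ℕ × ℕ => W x.1 x.2) '' (Set.Iic b ×ˢ Set.Iic b))).Finite :=
      ((Set.finite_Iic b).prod (Set.finite_Iic b)).image _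
    have hfin2 := hfin.preimage ((hW i).strictMono.injective.injOn (s := (W i) ⁻¹' _))
    obtain ⟨c, hc⟩ := hfin2.bddAbove
    refine ⟨max (c+1) ((Finset.range b).sup F), ?_, ?_⟩
    · intro m hm
      exact le_max_of_le_right (Finset.le_sup (f := F) (Finset.mem_range.2 hm))
    · intro q hq k' hk' h
      have := hc (show _ ∈ W i ⁻¹' _ from ⟨(q, k'), ⟨hq, hk'⟩, h.symm⟩)
      have := le_max_left (c+1) ((Finset.range b).sup F)
      omega
  choose kk hkF hkne using hk
  set H : ℕ → ℕ := fun b => (b + 1) + ((Finset.range (b+1)).sup (fun i => kk i b)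
    + (Finset.range (b+1)).sup (fun i => nx i (kk i b))) with hH
  have hH1 : ∀ b, b < H b := by intro b; simp only [hH]; omega
  have hH2 : ∀ b, ∀ i ≤ b, kk i b ≤ H b := by
    intro b i hi
    have := Finset.le_sup (f := fun i => kk i b) (Finset.mem_range.2 (Nat.lt_add_one_of_le hi))
    simp only [hH] at *; omega
  have hH3 : ∀ b, ∀ i ≤ b, nx i (kk i b) ≤ H b := by
    intro b i hi
    have := Finset.le_sup (f := fun i => nx i (kk i b)) (Finset.mem_range.2 (Nat.lt_add_one_of_le hi))
    simp only [hH] at *; omega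
  set a : ℕ → ℕ := fun j => H^[j] 0 with ha
  have hasucc : ∀ j, a (j+1) = H (a j) := fun j => Function.iterate_succ_apply' H j 0
  have hasm : StrictMono a := strictMono_nat_of_lt_succ fun j => by rw [hasucc]; exact hH1 _
  have hafind : ∀ m, ∃ j, a j ≤ m ∧ m < a (j+1) := by
    intro m
    induction m with
    | zero => exact ⟨0, le_rfl, by simpa using (hasm (Nat.lt_succ_self 0)).trans_le' (Nat.zero_le _)⟩
    | succ m ih =>
      obtain ⟨j, h1, h2⟩ := ih
      by_cases h : m + 1 < a (j+1)
      · exact ⟨j, by omega, h⟩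
      · exact ⟨j+1, by omega, by have := hasm (Nat.lt_succ_self (j+1)); simp at this; omega⟩
  -- choose the parity
  set P : ℕ → Set ℕ := fun e => {m | ∃ t, a (2*t+e) ≤ m ∧ m < a (2*t+e+1)} with hP
  have hPe : ∃ e, D '' P e ∈ ℬ := by
    have : Set.range D = D '' P 0 ∪ D '' P 1 := by
      rw [← Set.image_union, ← Set.image_univ]
      congr 1
      symm
      rw [Set.eq_univ_iff_forall]
      intro m
      obtain ⟨j, h1, h2⟩ := hafind m
      rcases Nat.even_or_odd' j with ⟨t, rfl | rfl⟩
      · left; exact ⟨t, h1, h2⟩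
      · right; exact ⟨t, h1, h2⟩
    rw [this] at hDB
    rcases hreg.2.1 _ _ hDB with h | h
    · exact ⟨0, h⟩
    · exact ⟨1, h⟩
  obtain ⟨e, he⟩ := hPe
  set p : ℕ → ℕ := fun t => Nat.rec 0 (fun t q => nx q (kk q (a (2*t+e+1)))) t with hp
  set g : ℕ → ℕ := fun t => kk (p t) (a (2*t+e+1)) with hg
  have hps : ∀ t, p (t+1) = nx (p t) (g t) := fun t => rfl
  have hpa : ∀ t, p t ≤ a (2*t+e) := by
    intro t
    induction t with
    | zero => exact Nat.zero_le _
    | succ t ih =>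
      rw [hps, show 2*(t+1)+e = (2*t+e+1)+1 by ring, hasucc]
      exact hH3 _ _ (ih.trans (hasm.monotone (Nat.le_succ _)))
  have hga : ∀ t, g t ≤ a (2*t+e+2) := by
    intro t
    rw [hasucc]
    exact hH2 _ _ ((hpa t).trans (hasm.monotone (Nat.le_succ _)))
  set V : ℕ → Set X := fun t => W (p t) (g t) with hV
  have hVlt : ∀ s t, s < t → V t ≠ V s := by
    intro s t hst
    apply hkne
    · exact (hpa s).trans (hasm.monotone (by omega))
    · exact (hga s).trans (hasm.monotone (by omega))
  have hVi : Function.Injective V := by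
    intro s t hst
    rcases lt_trichotomy s t with h | h | h
    · exact absurd hst.symm (hVlt _ _ h)
    · exact h
    · exact absurd hst (hVlt _ _ h)
  have hDV : ∀ t m, a (2*t+e) ≤ m → m < a (2*t+e+1) → D m ⊆ V t := by
    intro t m h1 h2
    exact (hDF m (p t) ((hpa t).trans h1)).trans
      ((hW _).strictMono.monotone (hkF _ _ m h2))
  have huniq : ∀ s t m, a (2*t+e) ≤ m → m < a (2*t+e+1) → a (2*s+e) ≤ m → m < a (2*s+e+1) →
      s = t := by
    intro s t m h1 h2 h3 h4
    have h5 := hasm.lt_iff_lt.1 (h1.trans_lt h4)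
    have h6 := hasm.lt_iff_lt.1 (h3.trans_lt h2)
    omega
  have hτ : ∃ τ : ℕ → ℕ, ∀ m ∈ P e, a (2*τ m+e) ≤ m ∧ m < a (2*τ m+e+1) := by
    have : ∀ m, ∃ t, m ∈ P e → a (2*t+e) ≤ m ∧ m < a (2*t+e+1) := by
      intro m
      by_cases h : m ∈ P e
      · obtain ⟨t, ht⟩ := h
        exact ⟨t, fun _ => ht⟩
      · exact ⟨0, fun h' => absurd h' h⟩
    choose τ hτ using this
    exact ⟨τ, hτ⟩
  obtain ⟨τ, hτ⟩ := hτ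
  set f : Set X → Set X := fun U => V (τ (Function.invFun D U)) with hf
  have hfD : ∀ m, f (D m) = V (τ m) := by
    intro m
    simp only [hf]
    rw [Function.leftInverse_invFun hDi m]
  refine ⟨p, g, rfl, hps, ?_⟩
  have key := hreg.2.2 _ he f (by
    rintro _ ⟨m, hm, rfl⟩
    rw [hfD]
    exact ⟨(hW _).1 _, (hW _).ne_univ _, hDV _ _ (hτ m hm).1 (hτ m hm).2⟩) (by
    intro V'
    by_cases h : ∃ t, V t = V'
    · obtain ⟨t, rfl⟩ := h
      apply ((Set.finite_Iio (a (2*t+e+1))).image D).subset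
      rintro _ ⟨⟨m, hm, rfl⟩, h2⟩
      rw [hfD] at h2
      have := hVi h2
      refine ⟨m, ?_, rfl⟩
      rw [← this]
      exact (hτ m hm).2
    · convert Set.finite_empty
      rw [Set.eq_empty_iff_forall_notMem]
      rintro _ ⟨⟨m, hm, rfl⟩, h2⟩
      exact h ⟨_, (hfD m) ▸ h2⟩)
  convert key using 1
  apply Set.Subset.antisymm
  · rintro _ ⟨t, rfl⟩
    have h1 : a (2*t+e) < a (2*t+e+1) := hasm (Nat.lt_succ_self _)
    have hm : a (2*t+e) ∈ P e := ⟨t, le_rfl, h1⟩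
    refine ⟨_, ⟨a (2*t+e), hm, rfl⟩, ?_⟩
    rw [hfD, huniq _ t _ le_rfl h1 (hτ _ hm).1 (hτ _ hm).2]
  · rintro _ ⟨_, ⟨m, hm, rfl⟩, rfl⟩
    rw [hfD]
    exact ⟨_, rfl⟩

/-- Translate a list of numbers (latest first) to a position in the game. -/
def toPos {α : Type*} (T : List α → ℕ → α) : List ℕ → List α
  | [] => []
  | k :: s => toPos T s ++ [T (toPos T s) k]

theorem lemmaC {X : Type*} [TopologicalSpace X]
    {ℬ : Set (Set (Set X))} (hreg : IsRegularFamily X ℬ) (hU : UfinProp ℬ)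
    {α : Type*} (T : List α → ℕ → α) (v : α → Set X)
    (hT : ∀ l, AscSeq (fun k => v (T l k))) :
    ∃ b : ℕ → α, (∀ n, ∃ k, b n = T (List.ofFn fun i : Fin n => b i) k) ∧
      Set.range (fun n => v (b n)) ∈ ℬ := by
  obtain ⟨p, g, hp0, hps, hB⟩ := lemmaB hreg hU
    (fun i k => v (T (toPos T (Denumerable.ofNat (List ℕ) i)) k)) (fun i => hT _)
    (fun i k => Encodable.encode (k :: Denumerable.ofNat (List ℕ) i))
  set b : ℕ → α := fun t => T (toPos T (Denumerable.ofNat (List ℕ) (p t))) (g t) with hb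
  have hpos : ∀ t, toPos T (Denumerable.ofNat (List ℕ) (p t)) = List.ofFn fun i : Fin t => b i := by
    intro t
    induction t with
    | zero =>
      have : Denumerable.ofNat (List ℕ) 0 = [] := by
        have := Denumerable.ofNat_encode ([] : List ℕ)
        simpa using this
      rw [hp0, this]; simp [toPos]
    | succ t ih =>
      rw [hps, Denumerable.ofNat_encode, List.ofFn_succ', List.concat_eq_append]
      simp only [toPos, Fin.val_castSucc, Fin.val_last]
      rw [← ih]
  refine ⟨b, fun n => ⟨g n, ?_⟩, hB⟩
  rw [← hpos]

theorem asc_of_cover {X : Type*} [TopologicalSpace X] (𝒰 : Set (Set X))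
    (h : 𝒰.Countable ∧ IsOpenCover 𝒰 ∧ NoFiniteSubcover 𝒰) :
    ∃ T : ℕ → Set (Set X), (∀ k, (T k).Finite ∧ T k ⊆ 𝒰) ∧ AscSeq (fun k => ⋃₀ T k) := by
  obtain ⟨hc, ⟨ho, hcov⟩, hn⟩ := h
  have hne : 𝒰.Nonempty := by
    rw [Set.nonempty_iff_ne_empty]
    rintro rfl
    exact hn ⟨∅, le_rfl, Set.finite_empty, hcov⟩
  obtain ⟨u, rfl⟩ := hc.exists_eq_range hne
  set C : ℕ → Set (Set X) := fun n => u '' Set.Iio n with hC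
  have hCf : ∀ n, (C n).Finite := fun n => (Set.finite_Iio n).image _
  have hCs : ∀ n, C n ⊆ Set.range u := fun n => Set.image_subset_range _ _
  have hCm : Monotone C := fun a b hab => Set.image_mono (Set.Iio_subset_Iio hab)
  have hmem : ∀ x, ∃ m, ∀ n, m < n → x ∈ ⋃₀ C n := by
    intro x
    have : x ∈ ⋃₀ Set.range u := by rw [hcov]; trivial
    obtain ⟨_, ⟨m, rfl⟩, hx⟩ := this
    exact ⟨m, fun n hmn => ⟨u m, ⟨m, hmn, rfl⟩, hx⟩⟩
  have hstep : ∀ n, ∃ m, n < m ∧ ⋃₀ C n ⊂ ⋃₀ C m := by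
    intro n
    have : ⋃₀ C n ≠ Set.univ := fun h => hn ⟨C n, hCs n, hCf n, h⟩
    obtain ⟨x, hx⟩ := (Set.ne_univ_iff_exists_notMem _).1 this
    obtain ⟨m, hm⟩ := hmem x
    refine ⟨max m n + 1, by omega, Set.sUnion_subset_sUnion (hCm (by omega)), fun h => hx (h (hm _ (by omega)))⟩
  choose nn hn1 hn2 using hstep
  have hφs : ∀ k, nn^[k+1] 0 = nn (nn^[k] 0) := fun k => Function.iterate_succ_apply' nn k 0
  have hφ : StrictMono (fun k => nn^[k] 0) := strictMono_nat_of_lt_succ fun k => by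
    rw [hφs]; exact hn1 _
  refine ⟨fun k => C (nn^[k] 0), fun k => ⟨hCf _, hCs _⟩, ?_, ?_, ?_⟩
  · intro k
    exact isOpen_sUnion fun U hU => ho U (hCs _ hU)
  · intro k
    change ⋃₀ C (nn^[k] 0) ⊂ ⋃₀ C (nn^[k+1] 0)
    rw [hφs]; exact hn2 _
  · rw [Set.eq_univ_iff_forall]
    intro x
    obtain ⟨m, hm⟩ := hmem x
    rw [Set.mem_iUnion]
    exact ⟨m+1, hm _ (lt_of_lt_of_le (Nat.lt_succ_self m) (hφ.id_le (m+1)))⟩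

/-- For a regular family `ℬ` of open covers of `X`, the following are equivalent:
(1) `Ufin(O(X), ℬ)`; (2) `S1(Asc(X), ℬ)`; (3) Alice has no winning strategy in
`G1(Asc(X), ℬ)`; (4) Alice has no winning strategy in the game associated to
`Ufin(O(X), ℬ)`. -/
theorem ufin_game_equivalences {X : Type*} [TopologicalSpace X]
    (ℬ : Set (Set (Set X))) (hreg : IsRegularFamily X ℬ) :
    (UfinProp ℬ ↔ S1Prop (AscCovers X) ℬ) ∧
    (UfinProp ℬ ↔ ¬∃ σ : List (Set X) → Set (Set X),
      IsWinningAliceStrategy (AscCovers X) ℬ σ) ∧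
    (UfinProp ℬ ↔ ¬∃ σ : List (Set (Set X)) → Set (Set X),
      IsWinningAliceUfin ℬ σ) := by
  have h13 : UfinProp ℬ → ¬∃ σ : List (Set X) → Set (Set X),
      IsWinningAliceStrategy (AscCovers X) ℬ σ := by
    rintro hU ⟨σ, hσ, hwin⟩
    choose V hV1 hV2 hV3 using fun l => (hσ l).2
    obtain ⟨b, hb, hB⟩ := lemmaC hreg hU V id
      (fun l => ⟨fun n => (hσ l).1.1 _ (hV2 l n), hV1 l, hV3 l⟩)
    refine hwin b (fun n => ?_) hB
    obtain ⟨k, hk⟩ := hb n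
    have := hV2 (List.ofFn fun i : Fin n => b i) k
    rwa [← hk] at this
  have h32 : (¬∃ σ : List (Set X) → Set (Set X),
      IsWinningAliceStrategy (AscCovers X) ℬ σ) → S1Prop (AscCovers X) ℬ := by
    intro h A hA
    by_contra hcon
    refine h ⟨fun l => A l.length, fun l => hA _, fun b hb hB => hcon ⟨b, fun n => ?_, hB⟩⟩
    simpa using hb n
  have h21 : S1Prop (AscCovers X) ℬ → UfinProp ℬ := by
    intro h 𝒰 h𝒰
    choose T hT hA using fun n => asc_of_cover (𝒰 n) (h𝒰 n)
    obtain ⟨b, hb, hB⟩ := h (fun n => Set.range fun k => ⋃₀ T n k) (fun n =>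
      ⟨⟨by rintro _ ⟨k, rfl⟩; exact (hA n).1 k, by rw [Set.sUnion_range]; exact (hA n).2.2⟩,
        _, (hA n).2.1, fun k => ⟨k, rfl⟩, (hA n).2.2⟩)
    choose g hg using hb
    refine ⟨fun n => T n (g n), fun n => hT _ _, ?_⟩
    convert hB using 2
    funext n
    exact hg n
  have h14 : UfinProp ℬ → ¬∃ σ : List (Set (Set X)) → Set (Set X),
      IsWinningAliceUfin ℬ σ := by
    rintro hU ⟨σ, hσ, hwin⟩
    choose T hT hA using fun l => asc_of_cover (σ l) (hσ l)
    obtain ⟨b, hb, hB⟩ := lemmaC hreg hU T (fun 𝒢 => ⋃₀ 𝒢) hA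
    refine hwin b (fun n => ?_) hB
    obtain ⟨k, hk⟩ := hb n
    have := hT (List.ofFn fun i : Fin n => b i) k
    rwa [← hk] at this
  have h41 : (¬∃ σ : List (Set (Set X)) → Set (Set X),
      IsWinningAliceUfin ℬ σ) → UfinProp ℬ := by
    intro h 𝒰 h𝒰
    by_contra hcon
    refine h ⟨fun l => 𝒰 l.length, fun l => h𝒰 _, fun b hb hB => hcon ⟨b, fun n => ?_, hB⟩⟩
    simpa using hb n
  exact ⟨⟨fun h => h32 (h13 h), h21⟩, ⟨h13, fun h => h21 (h32 h)⟩, ⟨h14, h41⟩⟩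
end

section
/- Let X be a topological space and ℬ a regular family of open covers of X. Assume that for each descending sequence 𝒰₁ ⊇ 𝒰₂ ⊇ ⋯ of countable point-infinite open covers of X with no finite subcover, there are nonempty disjoint finite sets ℱ₁ ⊆ 𝒰₁, ℱ₂ ⊆ 𝒰₂, … such that {⋃ℱₙ : n ∈ ℕ} ∈ ℬ. Then Ufin(O(X),ℬ) holds. -/
theorem aux_bnd {X : Type*} (V : ℕ → Set X) (hV : Monotone V) (T : Set (Set X)) (hT : T.Finite)
    (hb : ∀ U ∈ T, ∃ m, U ⊆ V m) : ∃ m, ⋃₀ T ⊆ V m := by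
  induction T, hT using Set.Finite.induction_on with
  | empty => exact ⟨0, by simp⟩
  | @insert a s ha hs ih =>
    obtain ⟨m, hm⟩ := ih (fun U hU => hb U (Set.mem_insert_of_mem _ hU))
    obtain ⟨m', hm'⟩ := hb a (Set.mem_insert _ _)
    refine ⟨max m m', ?_⟩
    rw [Set.sUnion_insert]
    exact Set.union_subset (hm'.trans (hV (le_max_right _ _))) (hm.trans (hV (le_max_left _ _)))

theorem aux_inf {X : Type*} (V : ℕ → Set X) (hV : Monotone V) (hc : ∀ x, ∃ m, x ∈ V m)
    (hne : ∀ m, V m ≠ Set.univ) (M : ℕ) : (V '' Set.Ici M).Infinite := by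
  intro hfin
  obtain ⟨m, hm⟩ := aux_bnd V hV _ hfin (by rintro U ⟨k, -, rfl⟩; exact ⟨k, subset_rfl⟩)
  apply hne m
  refine Set.eq_univ_of_forall fun x => ?_
  obtain ⟨k, hk⟩ := hc x
  exact hm ⟨V (max k M), ⟨_, Set.mem_Ici.2 (le_max_right _ _), rfl⟩, hV (le_max_left _ _) hk⟩

theorem aux_inj {α : Type*} (S : ℕ → Set α) (hS : ∀ n, (S n).Infinite) :
    ∃ g : ℕ → α, Function.Injective g ∧ ∀ n, g n ∈ S n := by
  classical
  choose t ht hc using fun n => (hS n).exists_subset_card_eq (n + 1)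
  obtain ⟨g, hg, hgt⟩ := (Finset.all_card_le_biUnion_card_iff_exists_injective t).1 (by
    intro s
    rcases s.eq_empty_or_nonempty with rfl | hs
    · simp
    · calc s.card ≤ (Finset.range (s.max' hs + 1)).card := by
            apply Finset.card_le_card
            intro x hx
            have := s.le_max' x hx
            simp; omega
        _ = (t (s.max' hs)).card := by rw [hc]; simp
        _ ≤ _ := Finset.card_le_card (Finset.subset_biUnion_of_mem t (s.max'_mem hs)))
  exact ⟨g, hg, fun n => ht n (hgt n)⟩

theorem aux_enum {α : Type*} (A : ℕ → α) (hA : (Set.range A).Infinite) :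
    ∃ k : ℕ → ℕ, (∀ j, j ≤ k j) ∧ Function.Injective (A ∘ k) ∧
      Set.range (A ∘ k) = Set.range A := by
  classical
  let p : ℕ → Prop := fun n => ∀ i < n, A i ≠ A n
  have hr : ∀ n, ∃ i, p i ∧ A i = A n := by
    intro n
    have hex : ∃ i, A i = A n := ⟨n, rfl⟩
    refine ⟨Nat.find hex, fun i hi h => Nat.find_min hex hi (h.trans (Nat.find_spec hex)),
      Nat.find_spec hex⟩
  have hinf : (Set.ofPred p).Infinite := by
    intro hf
    apply hA
    refine (hf.image A).subset ?_
    rintro _ ⟨n, rfl⟩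
    obtain ⟨i, hi, h⟩ := hr n
    exact ⟨i, hi, h⟩
  have hmono := Nat.nth_strictMono hinf
  have hmem := Nat.nth_mem_of_infinite hinf
  refine ⟨Nat.nth p, fun j => hmono.le_apply, ?_, ?_⟩
  · intro a b hab
    rcases lt_trichotomy a b with hlt | heq | hlt
    · exact absurd hab (hmem b _ (hmono hlt))
    · exact heq
    · exact absurd hab.symm (hmem a _ (hmono hlt))
  · apply Set.Subset.antisymm
    · rintro _ ⟨n, rfl⟩; exact ⟨_, rfl⟩
    · rintro _ ⟨n, rfl⟩
      obtain ⟨i, hi, h⟩ := hr n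
      have : i ∈ Set.range (Nat.nth p) := by rw [Nat.range_nth_of_infinite hinf]; exact hi
      obtain ⟨j, rfl⟩ := this
      exact ⟨j, h⟩

/-- Let `ℬ` be a regular family of open covers of `X`. If for each descending sequence
`𝒰₀ ⊇ 𝒰₁ ⊇ ⋯` of countable point-infinite open covers of `X` with no finite subcover
there are nonempty disjoint finite sets `ℱₙ ⊆ 𝒰ₙ` with `{⋃ℱₙ : n ∈ ℕ} ∈ ℬ`, then
`Ufin(O(X), ℬ)` holds. -/
theorem ufin_of_disjoint_selections {X : Type*} [TopologicalSpace X]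
    (ℬ : Set (Set (Set X))) (hreg : IsRegularFamily X ℬ)
    (h : ∀ 𝒰 : ℕ → Set (Set X), (∀ n, 𝒰 (n + 1) ⊆ 𝒰 n) →
      (∀ n, (𝒰 n).Countable ∧ IsOpenCover (𝒰 n) ∧
        (∀ x : X, {U ∈ 𝒰 n | x ∈ U}.Infinite) ∧ NoFiniteSubcover (𝒰 n)) →
      ∃ ℱ : ℕ → Set (Set X),
        (∀ n, (ℱ n).Finite ∧ (ℱ n).Nonempty ∧ ℱ n ⊆ 𝒰 n) ∧
        (∀ m n, m ≠ n → Disjoint (ℱ m) (ℱ n)) ∧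
        Set.range (fun n => ⋃₀ ℱ n) ∈ ℬ) :
    UfinProp ℬ := by
  classical
  obtain ⟨hcov, -, him⟩ := hreg
  intro 𝒰 h𝒰
  have hne : ∀ n, (𝒰 n).Nonempty := by
    intro n
    by_contra hn
    rw [Set.not_nonempty_iff_eq_empty] at hn
    have h1 := (h𝒰 n).2.1.2
    exact (h𝒰 n).2.2 ⟨𝒰 n, subset_rfl, by rw [hn]; exact Set.finite_empty, h1⟩
  choose e he using fun n => (h𝒰 n).1.exists_eq_range (hne n)
  let G : ℕ → ℕ → Set (Set X) := fun n m => e n '' Set.Iio m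
  have hGfin : ∀ n m, (G n m).Finite := fun n m => (Set.finite_Iio m).image _
  have hGsub : ∀ n m, G n m ⊆ 𝒰 n := by
    rintro n m _ ⟨k, -, rfl⟩
    rw [he n]; exact ⟨k, rfl⟩
  let V : ℕ → ℕ → Set X := fun n m => ⋃₀ G n m
  have hVmono : ∀ n, Monotone (V n) := fun n a b hab =>
    Set.sUnion_subset_sUnion (Set.image_mono (Set.Iio_subset_Iio hab))
  have hVne : ∀ n m, V n m ≠ Set.univ := fun n m hu =>
    (h𝒰 n).2.2 ⟨G n m, hGsub n m, hGfin n m, hu⟩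
  have hVopen : ∀ n m, IsOpen (V n m) := fun n m =>
    isOpen_sUnion fun U hU => (h𝒰 n).2.1.1 U (hGsub n m hU)
  have hVc : ∀ n x, ∃ m, x ∈ V n m := by
    intro n x
    have hx : x ∈ ⋃₀ 𝒰 n := by rw [(h𝒰 n).2.1.2]; trivial
    obtain ⟨U, hU, hxU⟩ := hx
    rw [he n] at hU
    obtain ⟨k, rfl⟩ := hU
    exact ⟨k + 1, _, ⟨k, Nat.lt_succ_self k, rfl⟩, hxU⟩
  let W : ℕ → ℕ → Set X := fun n m => ⋂ i ∈ Set.Iic n, V i m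
  have hWV : ∀ n m i, i ≤ n → W n m ⊆ V i m := fun n m i hi =>
    Set.biInter_subset_of_mem (Set.mem_Iic.2 hi)
  have hWmono : ∀ n, Monotone (W n) := fun n a b hab =>
    Set.iInter₂_mono fun i _ => hVmono i hab
  have hWanti : ∀ n k m, n ≤ k → W k m ⊆ W n m := fun n k m hnk =>
    Set.biInter_subset_biInter_left (Set.Iic_subset_Iic.2 hnk)
  have hWne : ∀ n m, W n m ≠ Set.univ := fun n m hu =>
    hVne n m (Set.univ_subset_iff.1 (hu ▸ hWV n m n le_rfl))
  have hWopen : ∀ n m, IsOpen (W n m) := fun n m =>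
    (Set.finite_Iic n).isOpen_biInter fun i _ => hVopen i m
  have hWc : ∀ n x, ∃ m, x ∈ W n m := by
    intro n x
    choose μ hμ using fun i => hVc i x
    refine ⟨(Finset.range (n + 1)).sup μ, Set.mem_iInter₂.2 fun i hi => ?_⟩
    refine hVmono i (Finset.le_sup (f := μ) ?_) (hμ i)
    simp only [Set.mem_Iic] at hi
    simp; omega
  let 𝒱 : ℕ → Set (Set X) := fun n => {S | ∃ k m, n ≤ k ∧ S = W k m}
  have h𝒱anti : ∀ n k, n ≤ k → 𝒱 k ⊆ 𝒱 n := by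
    rintro n k hnk _ ⟨a, m, ha, rfl⟩
    exact ⟨a, m, hnk.trans ha, rfl⟩
  have h𝒱fin : ∀ n T, T.Finite → T ⊆ 𝒱 n → ∃ m, ⋃₀ T ⊆ W n m := by
    intro n T hT hs
    refine aux_bnd (W n) (hWmono n) T hT fun U hU => ?_
    obtain ⟨k, m, hk, rfl⟩ := hs hU
    exact ⟨m, hWanti n k m hk⟩
  have h𝒱nf : ∀ n T, T.Finite → T ⊆ 𝒱 n → ⋃₀ T ≠ Set.univ := by
    intro n T hT hs hu
    obtain ⟨m, hm⟩ := h𝒱fin n T hT hs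
    exact hWne n m (Set.univ_subset_iff.1 (hu ▸ hm))
  obtain ⟨ℱ, hℱ, -, hℬ⟩ := h 𝒱 (fun n => h𝒱anti n _ (Nat.le_succ n)) (by
    intro n
    refine ⟨?_, ⟨?_, ?_⟩, ?_, ?_⟩
    · refine (Set.countable_range (fun q : ℕ × ℕ => W q.1 q.2)).mono ?_
      rintro _ ⟨k, m, -, rfl⟩
      exact ⟨(k, m), rfl⟩
    · rintro _ ⟨k, m, -, rfl⟩
      exact hWopen k m
    · refine Set.eq_univ_of_forall fun x => ?_
      obtain ⟨m, hm⟩ := hWc n x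
      exact ⟨_, ⟨n, m, le_rfl, rfl⟩, hm⟩
    · intro x
      obtain ⟨M, hM⟩ := hWc n x
      refine (aux_inf (W n) (hWmono n) (hWc n) (hWne n) M).mono ?_
      rintro _ ⟨m, hm, rfl⟩
      exact ⟨⟨n, m, le_rfl, rfl⟩, hWmono n hm hM⟩
    · rintro ⟨T, hs, hT, hu⟩
      exact h𝒱nf n T hT hs hu)
  let A : ℕ → Set X := fun n => ⋃₀ ℱ n
  have hℬ' : Set.range A ∈ ℬ := hℬ
  have hAW : ∀ n, ∃ m, A n ⊆ W n m := fun n => h𝒱fin n _ (hℱ n).1 (hℱ n).2.2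
  have hAinf : (Set.range A).Infinite := by
    intro hf
    obtain ⟨m, hm⟩ := aux_bnd (W 0) (hWmono 0) _ hf (by
      rintro _ ⟨n, rfl⟩
      obtain ⟨m, hm⟩ := hAW n
      exact ⟨m, hm.trans (hWanti 0 n m (Nat.zero_le n))⟩)
    rw [(hcov _ hℬ').2] at hm
    exact hWne 0 m (Set.univ_subset_iff.1 hm)
  obtain ⟨k, hk, hinj, hrange⟩ := aux_enum A hAinf
  choose M hM using hAW
  obtain ⟨g, hginj, hg⟩ := aux_inj (fun j => V j '' Set.Ici (M (k j)))
    (fun j => aux_inf (V j) (hVmono j) (hVc j) (hVne j) _)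
  choose μ hμ hμg using hg
  have hsub : ∀ j, A (k j) ⊆ g j := fun j => by
    rw [← hμg j]
    exact (hM (k j)).trans ((hWV _ _ j (hk j)).trans (hVmono j (hμ j)))
  refine ⟨fun j => G j (μ j), fun j => ⟨hGfin _ _, hGsub _ _⟩, ?_⟩
  have hgr : (fun j => ⋃₀ G j (μ j)) = g := funext hμg
  rw [hgr]
  let f : Set X → Set X := fun U => g (Function.invFun (A ∘ k) U)
  have hf : ∀ j, f (A (k j)) = g j := fun j =>
    congrArg g (Function.leftInverse_invFun hinj j)
  have himg : f '' Set.range A = Set.range g := by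
    rw [← hrange, ← Set.range_comp]
    exact congrArg Set.range (funext hf)
  rw [← himg]
  apply him _ hℬ'
  · rw [← hrange]
    rintro _ ⟨j, rfl⟩
    simp only [Function.comp_apply]
    rw [hf j]
    refine ⟨?_, ?_, hsub j⟩
    · rw [← hμg j]; exact hVopen _ _
    · rw [← hμg j]; exact hVne _ _
  · intro S
    apply Set.Subsingleton.finite
    rw [← hrange]
    rintro _ ⟨⟨a, rfl⟩, ha⟩ _ ⟨⟨b, rfl⟩, hb⟩
    simp only [Function.comp_apply] at ha hb
    rw [hf] at ha hb
    rw [hginj (ha.trans hb.symm)]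
end
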